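/- Let v be harmonic on the half-space H, continuous up to the closure, vanishing on {z₁ = 0}, and not identically zero. Then the Almgren frequency N(v)(r) is constant in r, equal to a value N̄, if and only if v is positively homogeneous of degree N̄, i.e. v(tz) = t^{N̄} v(z) for all t > 0 and z ∈ H. In that case, writing φ for the restriction of v to the upper unit hemisphere, the function z ↦ |z|^{N̄} φ(z/|z|) is harmonic on H; equivalently, N̄(N̄−1) + N̄(N−1) is an eigenvalue of the spherical Laplacian with Dirichlet conditions on the hemisphere and φ a corresponding eigenfunction. -/

import Mathlib

open MeasureTheory Filter Set Metric

noncomputable section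

/-- The Laplacian on `ℝ^N` (as `EuclideanSpace`): sum of the pure second partial
derivatives. -/
def lapE {d : ℕ} (u : EuclideanSpace ℝ (Fin (d+2)) → ℝ) (z : EuclideanSpace ℝ (Fin (d+2))) : ℝ :=
  ∑ i : Fin (d+2), fderiv ℝ (fun z' => fderiv ℝ u z' (EuclideanSpace.single i 1)) z
    (EuclideanSpace.single i 1)

/-- `|∇u|²`, the squared norm of the gradient. -/
def gradSqE {d : ℕ} (u : EuclideanSpace ℝ (Fin (d+2)) → ℝ) (z : EuclideanSpace ℝ (Fin (d+2))) : ℝ :=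
  ∑ i : Fin (d+2), (fderiv ℝ u z (EuclideanSpace.single i 1))^2

/-- The open half-space `H = {z ∈ ℝ^N : z₁ > 0}`. -/
def HalfSpace (d : ℕ) : Set (EuclideanSpace ℝ (Fin (d+2))) :=
  {z | 0 < z 0}

/-- A positive solution on the half-space `H`: continuous on the closure of `H`, twice
continuously differentiable and harmonic in `H`, positive in `H`, vanishing on `{z₁ = 0}`. -/
def IsPosSolHS {d : ℕ} (v : EuclideanSpace ℝ (Fin (d+2)) → ℝ) : Prop :=
  ContinuousOn v (closure (HalfSpace d)) ∧
  ContDiffOn ℝ 2 v (HalfSpace d) ∧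
  (∀ z ∈ HalfSpace d, lapE v z = 0) ∧
  (∀ z ∈ HalfSpace d, 0 < v z) ∧
  (∀ z : EuclideanSpace ℝ (Fin (d+2)), z 0 = 0 → v z = 0)

/-- The open upper unit hemisphere, as a subset of the unit sphere. -/
def Hemisphere (d : ℕ) : Set ↥(sphere (0 : EuclideanSpace ℝ (Fin (d+2))) 1) :=
  {θ | 0 < (θ : EuclideanSpace ℝ (Fin (d+2))) 0}

/-- The Almgren frequency on the half-space,
`N(v)(r) = (r^{2-N} ∫_{C_r} |∇v|²) / (r^{1-N} ∫_{Γ_r} v² dσ)`; here the boundary term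
`r^{1-N} ∫_{Γ_r} v² dσ` is written, by the scaling property of the surface measure, as the
integral over the unit hemisphere `∫_{S^{N-1}_+} v(rθ)² dσ(θ)` with respect to the surface
measure `volume.toSphere` on the unit sphere. -/
def freqHS {d : ℕ} (v : EuclideanSpace ℝ (Fin (d+2)) → ℝ) (r : ℝ) : ℝ :=
  (r ^ ((2:ℝ) - ((d:ℝ) + 2)) *
      ∫ z in HalfSpace d ∩ ball (0 : EuclideanSpace ℝ (Fin (d+2))) r, gradSqE v z) /
    (∫ θ in Hemisphere d, (v (r • (θ : EuclideanSpace ℝ (Fin (d+2)))))^2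
      ∂((volume : Measure (EuclideanSpace ℝ (Fin (d+2)))).toSphere))

section HalfSpaceHarmonic

open scoped ContDiff Topology Convolution Pointwise

/-- The Euclidean space `ℝ^(d+2)`. -/
abbrev ESp (d : ℕ) := EuclideanSpace ℝ (Fin (d + 2))

/-- The unit sphere of `ℝ^(d+2)`. -/
abbrev USph (d : ℕ) := sphere (0 : ESp d) 1

/-- The surface measure on the unit sphere of `ℝ^(d+2)`. -/
abbrev sphMeasure (d : ℕ) : Measure (USph d) := (volume : Measure (ESp d)).toSphere

/-- The `i`-th partial derivative. -/
abbrev pd {d : ℕ} (i : Fin (d + 2)) (u : ESp d → ℝ) (z : ESp d) : ℝ :=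
  fderiv ℝ u z (EuclideanSpace.single i 1)

variable {d : ℕ}

theorem continuous_integral_sphere {X : Type*} [TopologicalSpace X] [FirstCountableTopology X]
    [LocallyCompactSpace X] {F : X → USph d → ℝ} (hF : Continuous F.uncurry) :
    Continuous fun r => ∫ θ, F r θ ∂sphMeasure d := by
  simpa using continuous_parametric_integral_of_continuous (μ := sphMeasure d) hF
    (isCompact_univ : IsCompact (univ : Set (USph d)))

theorem hasDerivAt_integral_sphere {F F' : ℝ → USph d → ℝ}
    (hF : ∀ t, Continuous (F t)) (hF' : Continuous F'.uncurry)
    (h : ∀ t θ, HasDerivAt (F · θ) (F' t θ) t) (t : ℝ) :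
    HasDerivAt (fun t => ∫ θ, F t θ ∂sphMeasure d) (∫ θ, F' t θ ∂sphMeasure d) t := by
  obtain ⟨C, hC⟩ := ((isCompact_closedBall t 1).prod
    (isCompact_univ : IsCompact (univ : Set (USph d)))).exists_bound_of_continuousOn
    hF'.continuousOn
  refine (hasDerivAt_integral_of_dominated_loc_of_deriv_le (bound := fun _ => C)
    (closedBall_mem_nhds t one_pos)
    (.of_forall fun s => (hF s).aestronglyMeasurable)
    ((hF t).integrable_of_hasCompactSupport (HasCompactSupport.of_compactSpace _))
    (hF'.comp (Continuous.prodMk_right t)).aestronglyMeasurable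
    (.of_forall fun θ s hs => hC (s, θ) ⟨hs, mem_univ _⟩) (integrable_const C)
    (.of_forall fun θ s _ => h s θ)).2

/-- Integration in polar coordinates. -/
theorem integral_eq_integral_sphere {h : ESp d → ℝ} (hh : Integrable h) :
    ∫ x, h x = ∫ r in Ioi (0 : ℝ), r ^ (d + 1) * ∫ θ, h (r • (θ : ESp d)) ∂sphMeasure d := by
  have hmp := (volume : Measure (ESp d)).measurePreserving_homeomorphUnitSphereProd
  have hemb := (homeomorphUnitSphereProd (ESp d)).measurableEmbedding
  have hdim : Module.finrank ℝ (ESp d) - 1 = d + 1 := by simp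
  set g : USph d × Ioi (0 : ℝ) → ℝ := fun p => h (p.2.1 • (p.1 : ESp d)) with hg
  have hcomp : ∀ x : ({(0)}ᶜ : Set (ESp d)), g (homeomorphUnitSphereProd (ESp d) x) = h x := by
    intro x
    have hx : ‖(x : ESp d)‖ ≠ 0 := norm_ne_zero_iff.2 x.2
    simp [hg, smul_smul, mul_inv_cancel₀ hx]
  have hint : Integrable g ((sphMeasure d).prod (.volumeIoiPow (d + 1))) := by
    have := hmp.integrable_comp_emb (g := g) hemb
    rw [hdim] at this
    rw [← this]
    have h2 : (g ∘ homeomorphUnitSphereProd (ESp d)) = fun x => h x.1 := funext hcomp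
    rw [h2]
    exact (integrableOn_iff_comap_subtypeVal (by measurability)).1 hh.integrableOn
  calc ∫ x, h x = ∫ x : ({(0)}ᶜ : Set (ESp d)), h x ∂((volume : Measure (ESp d)).comap (↑)) := by
        rw [integral_subtype_comap (measurableSet_singleton _).compl h,
          restrict_compl_singleton]
    _ = ∫ p, g p ∂((sphMeasure d).prod (.volumeIoiPow (d + 1))) := by
        rw [← hdim, ← hmp.integral_comp hemb]
        simp only [hcomp]
    _ = ∫ r : Ioi (0 : ℝ), ∫ θ, g (θ, r) ∂sphMeasure d ∂(.volumeIoiPow (d + 1)) :=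
        integral_prod_symm g hint
    _ = _ := by
        simp only [Measure.volumeIoiPow, ENNReal.ofReal]
        rw [integral_withDensity_eq_integral_smul]
        · rw [integral_subtype_comap measurableSet_Ioi fun a ↦ Real.toNNReal (a ^ (d + 1)) •
            ∫ θ, h (a • (θ : ESp d)) ∂sphMeasure d]
          refine setIntegral_congr_fun measurableSet_Ioi fun x hx ↦ ?_
          simp only [NNReal.smul_def, Real.coe_toNNReal _ (pow_nonneg hx.out.le _), smul_eq_mul]
        · exact (measurable_subtype_coe.pow_const _).real_toNNReal

/-- Integration over a ball in polar coordinates. -/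
theorem setIntegral_ball_eq_integral_sphere {h : ESp d → ℝ} (hh : Continuous h) {R : ℝ}
    (hR : 0 ≤ R) :
    ∫ x in ball 0 R, h x =
      ∫ r in (0 : ℝ)..R, r ^ (d + 1) * ∫ θ, h (r • (θ : ESp d)) ∂sphMeasure d := by
  have hint : Integrable ((ball (0 : ESp d) R).indicator h) := by
    rw [integrable_indicator_iff measurableSet_ball]
    exact ((hh.continuousOn.integrableOn_compact (isCompact_closedBall 0 R)).mono_set
      ball_subset_closedBall)
  rw [← integral_indicator measurableSet_ball, integral_eq_integral_sphere hint,
    intervalIntegral.integral_of_le hR, integral_Ioc_eq_integral_Ioo]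
  symm
  rw [← Ioi_inter_Iio, ← setIntegral_indicator measurableSet_Iio]
  refine setIntegral_congr_fun measurableSet_Ioi fun r hr => ?_
  have hr : 0 < r := hr
  by_cases hrR : r < R
  · simp [indicator, hrR, norm_smul, abs_of_pos hr]
  · simp [indicator, hrR, norm_smul, abs_of_pos hr]

theorem setIntegral_Ioi_eq_intervalIntegral {h : ℝ → ℝ} {T : ℝ} (hT : 0 ≤ T)
    (h0 : ∀ t, T ≤ t → h t = 0) : ∫ t in Ioi 0, h t = ∫ t in (0 : ℝ)..T, h t := by
  rw [intervalIntegral.integral_of_le hT]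
  exact setIntegral_eq_of_subset_of_forall_sdiff_eq_zero measurableSet_Ioi Ioc_subset_Ioi_self
    fun t ht => h0 t (le_of_not_ge fun h => ht.2 ⟨ht.1, h⟩)

/-- The divergence theorem on a ball. -/
theorem setIntegral_ball_divergence {X : Fin (d + 2) → ESp d → ℝ}
    (hX : ∀ i, ContDiff ℝ 1 (X i)) {R : ℝ} (hR : 0 < R) :
    ∫ x in ball 0 R, ∑ i, pd i (X i) x =
      R ^ (d + 1) * ∫ θ, ∑ i, X i (R • (θ : ESp d)) * (θ : ESp d) i ∂sphMeasure d := by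
  have hpd : ∀ i, Continuous (pd i (X i)) := fun i =>
    ((hX i).continuous_fderiv one_ne_zero).clm_apply continuous_const
  have hXc : ∀ i, Continuous (X i) := fun i => (hX i).continuous
  have hD : Continuous fun x => ∑ i, pd i (X i) x := continuous_finsetSum _ fun i _ => hpd i
  set a : ℝ → ℝ := fun r => r ^ (d + 1) *
    ∫ θ, ∑ i, pd i (X i) (r • (θ : ESp d)) ∂sphMeasure d with ha
  set M : ℝ → ℝ := fun r => r ^ (d + 1) *
    ∫ θ, ∑ i, X i (r • (θ : ESp d)) * (θ : ESp d) i ∂sphMeasure d with hM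
  have hac : Continuous a := by
    refine (continuous_pow _).mul (continuous_integral_sphere ?_)
    exact hD.comp (by fun_prop : Continuous fun p : ℝ × USph d => p.1 • (p.2 : ESp d))
  have hMc : Continuous M := by
    refine (continuous_pow _).mul (continuous_integral_sphere ?_)
    refine continuous_finsetSum _ fun i _ => ?_
    exact ((hXc i).comp (by fun_prop : Continuous fun p : ℝ × USph d => p.1 • (p.2 : ESp d))).mul
      (by fun_prop)
  set A : ℝ → ℝ := fun r => ∫ t in (0 : ℝ)..r, a t with hA
  have hAd : ∀ r, HasDerivAt A (a r) r := fun r => hac.integral_hasStrictDerivAt 0 r |>.hasDerivAt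
  have hAc : Continuous A := continuous_iff_continuousAt.2 fun r => (hAd r).continuousAt
  suffices hAM : EqOn (fun r => M r - A r) 0 (Ioi 0) by
    rw [setIntegral_ball_eq_integral_sphere hD hR.le]
    have := hAM hR
    simp only [Pi.zero_apply, sub_eq_zero] at this
    exact this.symm
  refine Measure.eqOn_open_of_ae_eq (μ := volume) ?_ isOpen_Ioi (hMc.sub hAc).continuousOn
    continuousOn_const
  rw [EventuallyEq, ae_restrict_iff' measurableSet_Ioi]
  refine isOpen_Ioi.ae_eq_zero_of_integral_contDiff_smul_eq_zero
    ((hMc.sub hAc).locallyIntegrable.locallyIntegrableOn _) fun ψ hψ hψc hψs => ?_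
  have hψcont : Continuous ψ := hψ.continuous
  obtain ⟨T, hT0, hT⟩ : ∃ T : ℝ, 0 < T ∧ ∀ t, T ≤ t → ψ t = 0 := by
    obtain ⟨T, hT⟩ := hψc.bddAbove
    refine ⟨max T 0 + 1, by positivity, fun t ht => ?_⟩
    by_contra hne
    have := hT (subset_tsupport _ hne)
    have := le_max_left T 0
    linarith
  have hneg : ∀ t, t ≤ 0 → ψ t = 0 := fun t ht => by
    by_contra hne
    exact absurd (hψs (subset_tsupport _ hne)) (not_lt.2 ht)
  set Φ : ℝ → ℝ := fun s => ∫ t in s..T, ψ t with hΦ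
  have hΦd : ∀ s, HasDerivAt Φ (-ψ s) s := fun s =>
    intervalIntegral.integral_hasDerivAt_left (hψcont.intervalIntegrable _ _)
      hψcont.stronglyMeasurable.stronglyMeasurableAtFilter hψcont.continuousAt
  have hΦT : ∀ s, T ≤ s → Φ s = 0 := fun s hs => by
    simp only [hΦ]
    rw [intervalIntegral.integral_symm, intervalIntegral.integral_congr (g := fun _ => (0 : ℝ))]
    · simp
    · intro t ht
      rw [uIcc_of_le hs] at ht
      exact hT t ht.1
  have hΦC : ContDiff ℝ 1 Φ := by
    rw [contDiff_one_iff_deriv]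
    refine ⟨fun s => (hΦd s).differentiableAt, ?_⟩
    rw [funext fun s => (hΦd s).deriv]
    exact hψcont.neg
  set f : ESp d → ℝ := fun x => Φ ‖x‖ with hf
  have hf0 : f =ᶠ[𝓝 0] fun _ => Φ 0 := by
    have h0 : (0 : ℝ) ∉ tsupport ψ := fun h => lt_irrefl (0 : ℝ) (hψs h)
    have h1 : ∀ᶠ t in 𝓝 (0 : ℝ), ψ t = 0 := notMem_tsupport_iff_eventuallyEq.1 h0
    obtain ⟨δ, hδ, hδ'⟩ := Metric.eventually_nhds_iff_ball.1 h1
    filter_upwards [ball_mem_nhds (0 : ESp d) hδ] with x hx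
    rw [mem_ball_zero_iff] at hx
    simp only [hf, hΦ]
    rw [← intervalIntegral.integral_add_adjacent_intervals (a := 0) (b := ‖x‖) (c := T)
      (hψcont.intervalIntegrable _ _) (hψcont.intervalIntegrable _ _),
      intervalIntegral.integral_congr (g := fun _ => (0 : ℝ)) (b := ‖x‖)]
    · simp
    · intro t ht
      rw [uIcc_of_le (norm_nonneg x)] at ht
      refine hδ' t ?_
      rw [mem_ball_zero_iff, Real.norm_of_nonneg ht.1]
      exact ht.2.trans_lt hx
  have hfC : ContDiff ℝ 1 f := contDiff_iff_contDiffAt.2 fun x => by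
    rcases eq_or_ne x 0 with rfl | hx
    · exact contDiffAt_const.congr_of_eventuallyEq hf0
    · exact hΦC.contDiffAt.comp x (contDiffAt_norm ℝ hx)
  have hfpd : ∀ i x, pd i f x = -(ψ ‖x‖ * (x i / ‖x‖)) := fun i x => by
    rcases eq_or_ne x 0 with rfl | hx
    · simp [pd, hf0.fderiv_eq]
    · have h1 : HasFDerivAt (fun x : ESp d => ‖x‖) _ x :=
        (differentiableAt_id.norm ℝ hx).hasFDerivAt
      have h2 := (hΦd ‖x‖).comp_hasFDerivAt x h1
      have h3 : HasFDerivAt (fun x : ESp d => ‖x‖ ^ 2) _ x := h1.pow 2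
      have h4 := h3.unique (hasStrictFDerivAt_norm_sq x).hasFDerivAt
      have h5 := congrArg (fun L : ESp d →L[ℝ] ℝ => L (EuclideanSpace.single i 1)) h4
      have hx' : ‖x‖ ≠ 0 := norm_ne_zero_iff.2 hx
      simp [EuclideanSpace.inner_single_right] at h5
      have h6 : fderiv ℝ (fun x : ESp d => ‖x‖) x (EuclideanSpace.single i 1) = x i / ‖x‖ := by
        rw [eq_div_iff hx']; linarith
      have h7 : fderiv ℝ f x = _ := HasFDerivAt.fderiv h2
      simp only [pd]
      rw [h7]
      simp [h6]
  have hfs : HasCompactSupport f := HasCompactSupport.intro (isCompact_closedBall 0 T)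
    fun x hx => hΦT _ (by simpa using (not_le.1 fun h => hx (by simpa using h)).le)
  have hfpdc : ∀ i, Continuous (pd i f) := fun i =>
    (hfC.continuous_fderiv one_ne_zero).clm_apply continuous_const
  have hfpds : ∀ i, HasCompactSupport (pd i f) := fun i => hfs.fderiv_apply ℝ _
  have hI1 : ∀ i, Integrable fun x => pd i f x * X i x := fun i =>
    ((hfpdc i).mul (hXc i)).integrable_of_hasCompactSupport (hfpds i).mul_right
  have hI1n : ∀ i, Integrable fun x => -(pd i f x * X i x) := fun i => (hI1 i).neg
  have hI2 : ∀ i, Integrable fun x => f x * pd i (X i) x := fun i =>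
    (hfC.continuous.mul (hpd i)).integrable_of_hasCompactSupport hfs.mul_right
  have hparts : ∫ x, f x * ∑ i, pd i (X i) x = ∫ x, ∑ i, -(pd i f x * X i x) := by
    simp_rw [Finset.mul_sum]
    rw [integral_finsetSum _ fun i _ => hI2 i, integral_finsetSum _ fun i _ => hI1n i]
    refine Finset.sum_congr rfl fun i _ => ?_
    rw [integral_neg]
    exact integral_mul_fderiv_eq_neg_fderiv_mul_of_integrable (hI1 i) (hI2 i)
      ((hfC.continuous.mul (hXc i)).integrable_of_hasCompactSupport hfs.mul_right)
      (fun x _ => (hfC.differentiable one_ne_zero) x)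
      (fun x _ => ((hX i).differentiable one_ne_zero) x)
  have hI3 : Integrable fun x => f x * ∑ i, pd i (X i) x :=
    (hfC.continuous.mul hD).integrable_of_hasCompactSupport hfs.mul_right
  rw [integral_eq_integral_sphere hI3,
    integral_eq_integral_sphere (integrable_finsetSum _ fun i _ => hI1n i)] at hparts
  have hL : ∫ r in Ioi (0 : ℝ), r ^ (d + 1) * ∫ θ, f (r • (θ : ESp d)) *
      ∑ i, pd i (X i) (r • (θ : ESp d)) ∂sphMeasure d = ∫ r in (0 : ℝ)..T, Φ r * a r := by
    rw [← setIntegral_Ioi_eq_intervalIntegral hT0.le fun t ht => by rw [hΦT t ht, zero_mul]]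
    refine setIntegral_congr_fun measurableSet_Ioi fun r hr => ?_
    have hr : 0 < r := hr
    simp only [hf, ha, norm_smul, Real.norm_of_nonneg hr.le, norm_eq_of_mem_sphere, mul_one,
      integral_const_mul]
    ring
  have hRt : ∫ r in Ioi (0 : ℝ), r ^ (d + 1) * ∫ θ, ∑ i, -(pd i f (r • (θ : ESp d)) *
      X i (r • (θ : ESp d))) ∂sphMeasure d = ∫ r in (0 : ℝ)..T, ψ r * M r := by
    rw [← setIntegral_Ioi_eq_intervalIntegral hT0.le fun t ht => by rw [hT t ht, zero_mul]]
    refine setIntegral_congr_fun measurableSet_Ioi fun r hr => ?_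
    have hr : 0 < r := hr
    simp only [hfpd, hM, norm_smul, Real.norm_of_nonneg hr.le, norm_eq_of_mem_sphere, mul_one]
    rw [mul_left_comm, ← integral_const_mul (ψ r)]
    congr 2
    funext θ
    rw [Finset.mul_sum]
    refine Finset.sum_congr rfl fun i _ => ?_
    simp only [PiLp.smul_apply, smul_eq_mul]
    field_simp
  have hibp := intervalIntegral.integral_mul_deriv_eq_deriv_mul (a := 0) (b := T) (u := Φ) (v := A)
    (u' := fun s => -ψ s) (v' := a) (fun s _ => hΦd s) (fun s _ => hAd s)
    (hψcont.neg.intervalIntegrable _ _) (hac.intervalIntegrable _ _)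
  have hA0 : A 0 = 0 := by simp [hA]
  rw [hΦT T le_rfl, hA0] at hibp
  rw [hL, hRt, hibp] at hparts
  have hfin : ∫ t, ψ t • (M t - A t) = ∫ t in (0 : ℝ)..T, ψ t * (M t - A t) := by
    rw [← setIntegral_Ioi_eq_intervalIntegral hT0.le fun t ht => by rw [hT t ht, zero_mul]]
    simp only [smul_eq_mul]
    exact (setIntegral_eq_integral_of_forall_compl_eq_zero fun t ht => by
      rw [hneg t (not_lt.1 ht), zero_mul]).symm
  rw [hfin]
  simp only [mul_sub]
  have hψM : IntervalIntegrable (fun t => ψ t * M t) volume 0 T :=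
    (hψcont.mul hMc).intervalIntegrable _ _
  have hψA : IntervalIntegrable (fun t => ψ t * A t) volume 0 T :=
    (hψcont.mul hAc).intervalIntegrable _ _
  rw [intervalIntegral.integral_sub hψM hψA, ← hparts]
  simp

theorem pd_mul {f g : ESp d → ℝ} {z : ESp d} (hf : DifferentiableAt ℝ f z)
    (hg : DifferentiableAt ℝ g z) (i : Fin (d + 2)) :
    pd i (fun x => f x * g x) z = f z * pd i g z + pd i f z * g z := by
  simp only [pd]
  rw [fderiv_fun_mul hf hg]
  simp [mul_comm]

theorem ContDiff.pd_contDiff {u : ESp d → ℝ} {m n : WithTop ℕ∞} (hu : ContDiff ℝ n u)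
    (hmn : m + 1 ≤ n) (i : Fin (d + 2)) : ContDiff ℝ m (pd i u) :=
  (hu.fderiv_right hmn).clm_apply contDiff_const

/-- Green's first identity on a ball against a harmonic function. -/
theorem setIntegral_ball_green {f g : ESp d → ℝ} (hf : ContDiff ℝ 1 f) (hg : ContDiff ℝ 2 g)
    (hlap : ∀ x, lapE g x = 0) {R : ℝ} (hR : 0 < R) :
    ∫ x in ball 0 R, ∑ i, pd i f x * pd i g x =
      R ^ (d + 1) * ∫ θ, ∑ i, f (R • (θ : ESp d)) * pd i g (R • (θ : ESp d)) * (θ : ESp d) i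
        ∂sphMeasure d := by
  have hg1 : ∀ i, ContDiff ℝ 1 (pd i g) := fun i => hg.pd_contDiff (by norm_num) i
  rw [← setIntegral_ball_divergence (X := fun i x => f x * pd i g x)
    (fun i => hf.mul (hg1 i)) hR]
  congr 1
  funext x
  have h : ∑ i, pd i (pd i g) x = 0 := hlap x
  simp only [pd_mul (hf.differentiable one_ne_zero x) ((hg1 _).differentiable one_ne_zero x)]
  rw [Finset.sum_add_distrib, ← Finset.mul_sum, h]
  simp

theorem pd_const_mul (u : ESp d → ℝ) (c : ℝ) (i : Fin (d + 2)) (x : ESp d) :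
    pd i (fun y => c * u y) x = c * pd i u x := by
  have h : (fun y => c * u y) = c • u := rfl
  simp only [pd]
  rw [h, fderiv_const_smul_field]
  simp

theorem pd_comp_smul (u : ESp d → ℝ) (c : ℝ) (i : Fin (d + 2)) (x : ESp d) :
    pd i (fun y => u (c • y)) x = c * pd i u (c • x) := by
  simp only [pd]
  rw [fderiv_comp_smul]
  simp

theorem lapE_comp_smul (u : ESp d → ℝ) (c : ℝ) (x : ESp d) :
    lapE (fun y => u (c • y)) x = c ^ 2 * lapE u (c • x) := by
  change ∑ i, pd i (pd i (fun y => u (c • y))) x = c ^ 2 * ∑ i, pd i (pd i u) (c • x)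
  rw [Finset.mul_sum]
  refine Finset.sum_congr rfl fun i _ => ?_
  rw [show pd i (fun y => u (c • y)) = fun x => c * pd i u (c • x) from
    funext (pd_comp_smul u c i), pd_const_mul (fun x => pd i u (c • x)), pd_comp_smul (pd i u)]
  ring

theorem sum_pd_mul (u : ESp d → ℝ) (z w : ESp d) : ∑ i, pd i u z * w i = fderiv ℝ u z w := by
  conv_rhs => rw [← (EuclideanSpace.basisFun (Fin (d + 2)) ℝ).sum_repr w]
  simp [pd, mul_comm]

/-- The Dirichlet energy of a harmonic function on a ball as a boundary integral. -/
theorem setIntegral_ball_gradSqE {u : ESp d → ℝ} (hu : ContDiff ℝ 2 u) (hlap : ∀ x, lapE u x = 0)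
    {r : ℝ} (hr : 0 < r) :
    ∫ x in ball 0 r, gradSqE u x =
      r ^ (d + 1) * ∫ θ, u (r • (θ : ESp d)) * fderiv ℝ u (r • (θ : ESp d)) θ ∂sphMeasure d := by
  have h := setIntegral_ball_green (hu.of_le one_le_two) hu hlap hr
  simp only [mul_assoc, ← Finset.mul_sum, sum_pd_mul] at h
  rw [← h]
  simp only [gradSqE, sq]

/-- Symmetry of the Dirichlet-to-Neumann form on dilates of a harmonic function. -/
theorem integral_sphere_dilate_symm {u : ESp d → ℝ} (hu : ContDiff ℝ 2 u)
    (hlap : ∀ x, lapE u x = 0) (a b : ℝ) :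
    ∫ θ, u (a • (θ : ESp d)) * (b * fderiv ℝ u (b • (θ : ESp d)) θ) ∂sphMeasure d =
      ∫ θ, u (b • (θ : ESp d)) * (a * fderiv ℝ u (a • (θ : ESp d)) θ) ∂sphMeasure d := by
  have hdil : ∀ c : ℝ, ContDiff ℝ 2 fun x => u (c • x) := fun c =>
    hu.comp (contDiff_const_smul c)
  have key : ∀ a b : ℝ, ∫ x in ball 0 1, ∑ i, pd i (fun x => u (a • x)) x *
      pd i (fun x => u (b • x)) x =
      ∫ θ, u (a • (θ : ESp d)) * (b * fderiv ℝ u (b • (θ : ESp d)) θ) ∂sphMeasure d := by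
    intro a b
    have h := setIntegral_ball_green ((hdil a).of_le one_le_two) (hdil b)
      (fun x => by rw [lapE_comp_smul, hlap, mul_zero]) one_pos
    rw [h]
    simp only [mul_assoc, ← Finset.mul_sum, sum_pd_mul, fderiv_comp_smul]
    simp
  rw [← key a b, ← key b a]
  simp only [mul_comm]

theorem hasDerivAt_comp_exp_smul {u : ESp d → ℝ} (hu : Differentiable ℝ u) (x : ESp d) (τ : ℝ) :
    HasDerivAt (fun τ => u (Real.exp τ • x))
      (Real.exp τ * fderiv ℝ u (Real.exp τ • x) x) τ := by
  have h := (hu (Real.exp τ • x)).hasFDerivAt.comp_hasDerivAt τ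
    ((Real.hasDerivAt_exp τ).smul_const x)
  simpa [Function.comp_def] using h

theorem continuous_comp_smul_sphere {f : ESp d → ℝ} (hf : Continuous f) {X : Type*}
    [TopologicalSpace X] {c : X → ℝ} (hc : Continuous c) :
    Continuous fun p : X × USph d => f (c p.1 • (p.2 : ESp d)) :=
  hf.comp ((hc.comp continuous_fst).smul (continuous_subtype_val.comp continuous_snd))

theorem continuous_fderiv_smul_sphere {u : ESp d → ℝ} (hu : ContDiff ℝ 2 u) {X : Type*}
    [TopologicalSpace X] {c : X → ℝ} (hc : Continuous c) :
    Continuous fun p : X × USph d => fderiv ℝ u (c p.1 • (p.2 : ESp d)) p.2 :=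
  ((hu.continuous_fderiv two_ne_zero).comp
    ((hc.comp continuous_fst).smul (continuous_subtype_val.comp continuous_snd))).clm_apply
    (continuous_subtype_val.comp continuous_snd)

theorem integral_sphere_mul_dilate {u : ESp d → ℝ} (hu : ContDiff ℝ 2 u)
    (hlap : ∀ x, lapE u x = 0) (σ τ : ℝ) :
    ∫ θ, u (Real.exp (σ + τ) • (θ : ESp d)) * u (Real.exp (σ - τ) • (θ : ESp d)) ∂sphMeasure d =
      ∫ θ, u (Real.exp σ • (θ : ESp d)) ^ 2 ∂sphMeasure d := by
  have hd : Differentiable ℝ u := hu.differentiable two_ne_zero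
  have hderiv : ∀ τ : ℝ, HasDerivAt (fun τ => ∫ θ, u (Real.exp (σ + τ) • (θ : ESp d)) *
      u (Real.exp (σ - τ) • (θ : ESp d)) ∂sphMeasure d) 0 τ := by
    intro τ
    have h := hasDerivAt_integral_sphere (d := d)
      (F := fun τ θ => u (Real.exp (σ + τ) • (θ : ESp d)) * u (Real.exp (σ - τ) • (θ : ESp d)))
      (F' := fun τ θ => u (Real.exp (σ - τ) • (θ : ESp d)) *
          (Real.exp (σ + τ) * fderiv ℝ u (Real.exp (σ + τ) • (θ : ESp d)) θ) -
        u (Real.exp (σ + τ) • (θ : ESp d)) *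
          (Real.exp (σ - τ) * fderiv ℝ u (Real.exp (σ - τ) • (θ : ESp d)) θ))
      (fun t => by have := hu.continuous; fun_prop) ?_ ?_ τ
    · convert h using 1
      rw [integral_sub, integral_sphere_dilate_symm hu hlap, sub_self]
      · refine Continuous.integrable_of_hasCompactSupport ?_ (HasCompactSupport.of_compactSpace _)
        exact ((continuous_comp_smul_sphere hu.continuous continuous_const).mul
          (continuous_const.mul (continuous_fderiv_smul_sphere hu continuous_const))).comp
            (Continuous.prodMk_right (0 : ℝ))
      · refine Continuous.integrable_of_hasCompactSupport ?_ (HasCompactSupport.of_compactSpace _)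
        exact ((continuous_comp_smul_sphere hu.continuous continuous_const).mul
          (continuous_const.mul (continuous_fderiv_smul_sphere hu continuous_const))).comp
            (Continuous.prodMk_right (0 : ℝ))
    · have hp : Continuous fun τ => Real.exp (σ + τ) := by fun_prop
      have hm : Continuous fun τ => Real.exp (σ - τ) := by fun_prop
      exact ((continuous_comp_smul_sphere hu.continuous hm).mul
        ((hp.comp continuous_fst).mul (continuous_fderiv_smul_sphere hu hp))).sub
        ((continuous_comp_smul_sphere hu.continuous hp).mul
        ((hm.comp continuous_fst).mul (continuous_fderiv_smul_sphere hu hm)))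
    · intro t θ
      have h1 := (hasDerivAt_comp_exp_smul hd θ (σ + t)).comp t ((hasDerivAt_id t).const_add σ)
      have h2 := (hasDerivAt_comp_exp_smul hd θ (σ - t)).comp t ((hasDerivAt_id t).const_sub σ)
      refine (h1.mul h2).congr_deriv ?_
      simp
      ring
  have := is_const_of_deriv_eq_zero (fun t => (hderiv t).differentiableAt)
    (fun t => (hderiv t).deriv) τ 0
  simpa [sq] using this

theorem integral_sphere_sq_exp {u : ESp d → ℝ} (hu : ContDiff ℝ 2 u) {Nbar : ℝ}
    (hN : ∀ r : ℝ, 0 < r → r * ∫ θ, u (r • (θ : ESp d)) * fderiv ℝ u (r • (θ : ESp d)) θ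
      ∂sphMeasure d = Nbar * ∫ θ, u (r • (θ : ESp d)) ^ 2 ∂sphMeasure d) (τ : ℝ) :
    ∫ θ, u (Real.exp τ • (θ : ESp d)) ^ 2 ∂sphMeasure d =
      Real.exp (2 * Nbar * τ) * ∫ θ : USph d, u θ ^ 2 ∂sphMeasure d := by
  have hd : Differentiable ℝ u := hu.differentiable two_ne_zero
  set h : ℝ → ℝ := fun τ => ∫ θ, u (Real.exp τ • (θ : ESp d)) ^ 2 ∂sphMeasure d with hh
  have hderiv : ∀ τ, HasDerivAt h (2 * Nbar * h τ) τ := by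
    intro τ
    have h1 := hasDerivAt_integral_sphere (d := d)
      (F := fun τ θ => u (Real.exp τ • (θ : ESp d)) ^ 2)
      (F' := fun τ θ => 2 * Real.exp τ * (u (Real.exp τ • (θ : ESp d)) *
          fderiv ℝ u (Real.exp τ • (θ : ESp d)) θ))
      (fun t => by have := hu.continuous; fun_prop) ?_ ?_ τ
    · refine h1.congr_deriv ?_
      rw [integral_const_mul, mul_assoc, hN _ (Real.exp_pos τ), mul_assoc]
    · have hp : Continuous fun τ => Real.exp τ := by fun_prop
      exact (continuous_const.mul (hp.comp continuous_fst)).mul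
        ((continuous_comp_smul_sphere hu.continuous hp).mul (continuous_fderiv_smul_sphere hu hp))
    · intro t θ
      refine ((hasDerivAt_comp_exp_smul hd θ t).pow 2).congr_deriv ?_
      push_cast
      ring
  have hconst : ∀ τ, HasDerivAt (fun τ => Real.exp (-(2 * Nbar * τ)) * h τ) 0 τ := by
    intro τ
    have h1 : HasDerivAt (fun τ : ℝ => Real.exp (-(2 * Nbar * τ)))
        (Real.exp (-(2 * Nbar * τ)) * (-(2 * Nbar * 1))) τ :=
      (((hasDerivAt_id τ).const_mul (2 * Nbar)).neg).exp
    refine (h1.mul (hderiv τ)).congr_deriv ?_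
    ring
  have h2 := is_const_of_deriv_eq_zero (fun t => (hconst t).differentiableAt)
    (fun t => (hconst t).deriv) τ 0
  have h3 : h 0 = ∫ θ : USph d, u θ ^ 2 ∂sphMeasure d := by simp [hh]
  rw [← h3]
  simp only [mul_zero, neg_zero, Real.exp_zero, one_mul] at h2
  rw [← h2, ← mul_assoc, ← Real.exp_add]
  simp [hh]

theorem eq_zero_of_integral_sphere_sq_eq_zero {f : USph d → ℝ} (hf : Continuous f)
    (h : ∫ θ, f θ ^ 2 ∂sphMeasure d = 0) (θ : USph d) : f θ = 0 := by
  have hI : Integrable (fun θ => f θ ^ 2) (sphMeasure d) :=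
    (hf.pow 2).integrable_of_hasCompactSupport (HasCompactSupport.of_compactSpace _)
  rw [integral_eq_zero_iff_of_nonneg (fun θ => sq_nonneg (f θ)) hI] at h
  have h1 := congrFun ((hf.pow 2).ae_eq_iff_eq (sphMeasure d) continuous_const |>.1 h) θ
  exact pow_eq_zero_iff two_ne_zero |>.1 h1

/-- A harmonic function whose spherical energies satisfy the constant-frequency identity is
positively homogeneous. -/
theorem homogeneous_of_frequency_eq {u : ESp d → ℝ} (hu : ContDiff ℝ 2 u)
    (hlap : ∀ x, lapE u x = 0) {Nbar : ℝ}
    (hN : ∀ r : ℝ, 0 < r → r * ∫ θ, u (r • (θ : ESp d)) * fderiv ℝ u (r • (θ : ESp d)) θ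
      ∂sphMeasure d = Nbar * ∫ θ, u (r • (θ : ESp d)) ^ 2 ∂sphMeasure d)
    {t : ℝ} (ht : 0 < t) {z : ESp d} (hz : z ≠ 0) : u (t • z) = t ^ Nbar * u z := by
  have hz' : 0 < ‖z‖ := norm_pos_iff.2 hz
  obtain ⟨σ, hσ⟩ : ∃ σ, Real.exp σ = ‖z‖ := ⟨_, Real.exp_log hz'⟩
  obtain ⟨τ, hτ⟩ : ∃ τ, Real.exp (2 * τ) = t :=
    ⟨Real.log t / 2, by rw [mul_div_cancel₀ _ two_ne_zero, Real.exp_log ht]⟩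
  have hc : ∀ s : ℝ, Continuous fun θ : USph d => u (s • (θ : ESp d)) := fun s => by
    have := hu.continuous
    fun_prop
  have hI : ∀ f : USph d → ℝ, Continuous f → Integrable f (sphMeasure d) := fun f hf =>
    hf.integrable_of_hasCompactSupport (HasCompactSupport.of_compactSpace _)
  have h1 := integral_sphere_sq_exp hu hN σ
  have h2 := integral_sphere_sq_exp hu hN (σ + 2 * τ)
  have h3 := integral_sphere_sq_exp hu hN (σ + τ)
  have h4 := integral_sphere_mul_dilate hu hlap (σ + τ) τ
  rw [h3, show σ + τ + τ = σ + 2 * τ by ring, show σ + τ - τ = σ by ring] at h4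
  have htN : t ^ Nbar = Real.exp (2 * Nbar * τ) := by
    rw [← hτ, ← Real.exp_mul]
    ring_nf
  have hzero : ∫ θ, (u (Real.exp (σ + 2 * τ) • (θ : ESp d)) -
      t ^ Nbar * u (Real.exp σ • (θ : ESp d))) ^ 2 ∂sphMeasure d = 0 := by
    have hexp : ∀ θ : USph d, (u (Real.exp (σ + 2 * τ) • (θ : ESp d)) -
      t ^ Nbar * u (Real.exp σ • (θ : ESp d))) ^ 2 = u (Real.exp (σ + 2 * τ) • (θ : ESp d)) ^ 2 +
        ((t ^ Nbar) ^ 2 * u (Real.exp σ • (θ : ESp d)) ^ 2 - 2 * t ^ Nbar *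
        (u (Real.exp (σ + 2 * τ) • (θ : ESp d)) * u (Real.exp σ • (θ : ESp d)))) := fun θ => by
      ring
    simp only [hexp]
    have hI1 : Integrable (fun θ : USph d => u (Real.exp (σ + 2 * τ) • (θ : ESp d)) ^ 2)
      (sphMeasure d) := hI _ ((hc _).pow 2)
    have hI2 : Integrable (fun θ : USph d => (t ^ Nbar) ^ 2 * u (Real.exp σ • (θ : ESp d)) ^ 2)
      (sphMeasure d) := hI _ (continuous_const.mul ((hc _).pow 2))
    have hI3 : Integrable (fun θ : USph d => 2 * t ^ Nbar *
        (u (Real.exp (σ + 2 * τ) • (θ : ESp d)) * u (Real.exp σ • (θ : ESp d))))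
      (sphMeasure d) := hI _ (continuous_const.mul ((hc _).mul (hc _)))
    have hI4 : Integrable (fun θ : USph d => (t ^ Nbar) ^ 2 * u (Real.exp σ • (θ : ESp d)) ^ 2 -
        2 * t ^ Nbar * (u (Real.exp (σ + 2 * τ) • (θ : ESp d)) * u (Real.exp σ • (θ : ESp d))))
      (sphMeasure d) := hI2.sub hI3
    rw [integral_add hI1 hI4, integral_sub hI2 hI3, integral_const_mul,
      integral_const_mul,
      h1, h2, h4, htN]
    rw [show 2 * Nbar * (σ + 2 * τ) = 2 * Nbar * σ + (2 * Nbar * τ + 2 * Nbar * τ) by ring,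
      show 2 * Nbar * (σ + τ) = 2 * Nbar * σ + 2 * Nbar * τ by ring, Real.exp_add, Real.exp_add,
      Real.exp_add]
    ring
  have hθ : u (Real.exp (σ + 2 * τ) • ‖z‖⁻¹ • z) - t ^ Nbar * u (Real.exp σ • ‖z‖⁻¹ • z) = 0 :=
    eq_zero_of_integral_sphere_sq_eq_zero
    ((hc _).sub (continuous_const.mul (hc _))) hzero
      ⟨‖z‖⁻¹ • z, by simp [norm_smul, inv_mul_cancel₀ hz'.ne']⟩
  rw [Real.exp_add, hσ, hτ] at hθ
  have hz1 : ‖z‖ • ‖z‖⁻¹ • z = z := by rw [smul_smul, mul_inv_cancel₀ hz'.ne', one_smul]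
  rw [mul_comm, mul_smul, hz1] at hθ
  linarith

theorem contDiff_two_of_deriv {G η : ℝ → ℝ} (hη : ContDiff ℝ 1 η) (hG : ∀ s, HasDerivAt G (η s) s) :
    ContDiff ℝ 2 G := by
  have h : deriv G = η := funext fun s => (hG s).deriv
  rw [show (2 : WithTop ℕ∞) = 1 + 1 by norm_num, contDiff_succ_iff_deriv]
  exact ⟨fun s => (hG s).differentiableAt, by simp, h ▸ hη⟩

theorem pd_radial {G η : ℝ → ℝ} (hG : ∀ s, HasDerivAt G (η s) s) (a : ℝ) (i : Fin (d + 2))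
    (z : ESp d) : pd i (fun y => G (a * ‖y‖ ^ 2)) z = 2 * a * (z i * η (a * ‖z‖ ^ 2)) := by
  have h1 : HasFDerivAt (fun y : ESp d => a * ‖y‖ ^ 2) (a • (2 • innerSL ℝ z)) z :=
    (hasStrictFDerivAt_norm_sq z).hasFDerivAt.const_mul a
  have h2 := (hG (a * ‖z‖ ^ 2)).comp_hasFDerivAt z h1
  rw [pd, show (fun y : ESp d => G (a * ‖y‖ ^ 2)) = G ∘ fun y => a * ‖y‖ ^ 2 from rfl, h2.fderiv]
  simp [EuclideanSpace.inner_single_right]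
  ring

/-- The Laplacian of a radial function. -/
theorem lapE_radial {G η : ℝ → ℝ} (hη : ContDiff ℝ 1 η) (hG : ∀ s, HasDerivAt G (η s) s) (a : ℝ)
    (z : ESp d) : lapE (fun y => G (a * ‖y‖ ^ 2)) z =
      2 * a * ((d + 2) * η (a * ‖z‖ ^ 2) + 2 * a * ‖z‖ ^ 2 * deriv η (a * ‖z‖ ^ 2)) := by
  change ∑ i, pd i (pd i (fun y => G (a * ‖y‖ ^ 2))) z = _
  have hd : ∀ s, HasDerivAt η (deriv η s) s := fun s =>
    (hη.differentiable one_ne_zero s).hasDerivAt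
  have hi : ∀ i, pd i (pd i (fun y : ESp d => G (a * ‖y‖ ^ 2))) z =
      2 * a * (η (a * ‖z‖ ^ 2) + 2 * a * deriv η (a * ‖z‖ ^ 2) * z i ^ 2) := by
    intro i
    have hcoord : ∀ y : ESp d, pd i (fun y => y i) y = 1 := fun y => by
      have : HasFDerivAt (fun y : ESp d => y i) (EuclideanSpace.proj i : ESp d →L[ℝ] ℝ) y :=
        (EuclideanSpace.proj i : ESp d →L[ℝ] ℝ).hasFDerivAt
      simp [pd, this.fderiv]
    rw [show pd i (fun y : ESp d => G (a * ‖y‖ ^ 2)) =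
      fun y => 2 * a * (y i * η (a * ‖y‖ ^ 2)) from funext (pd_radial hG a i),
      pd_const_mul (fun y : ESp d => y i * η (a * ‖y‖ ^ 2)), pd_mul, pd_radial hd, hcoord]
    · ring
    · fun_prop
    · exact ((hη.comp (contDiff_const.mul (contDiff_norm_sq ℝ))).differentiable one_ne_zero) z
  have hnorm : ∑ i, z i ^ 2 = ‖z‖ ^ 2 := by simp [EuclideanSpace.norm_sq_eq]
  simp only [hi, ← Finset.mul_sum, Finset.sum_add_distrib, hnorm]
  simp only [Finset.sum_const, Finset.card_univ, Fintype.card_fin, nsmul_eq_mul]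
  push_cast
  ring

/-- Differentiation under the integral sign for compactly supported kernels. -/
theorem hasDerivAt_integral_mul_kernel {w : ESp d → ℝ} (hw : Continuous w) {K K' : ℝ → ESp d → ℝ}
    (hK : ∀ s, Continuous (K s)) (hK' : Continuous K'.uncurry)
    (h : ∀ s z, HasDerivAt (K · z) (K' s z) s) {R : ℝ} {s₀ : ℝ}
    (hsupp : ∀ s ∈ ball s₀ 1, ∀ z, R ≤ ‖z‖ → K s z = 0) :
    HasDerivAt (fun s => ∫ z, w z * K s z) (∫ z, w z * K' s₀ z) s₀ := by
  have hsupp' : ∀ s ∈ ball s₀ 1, ∀ z, R ≤ ‖z‖ → K' s z = 0 := fun s hs z hz => by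
    refine (h s z).unique ((hasDerivAt_const s (0 : ℝ)).congr_of_eventuallyEq ?_)
    filter_upwards [isOpen_ball.mem_nhds hs] with t ht using hsupp t ht z hz
  have hsub : ∀ {f : ESp d → ℝ}, (∀ z, R ≤ ‖z‖ → f z = 0) → HasCompactSupport f := fun hf =>
    HasCompactSupport.intro (isCompact_closedBall (0 : ESp d) R) fun z hz => hf z
      (by simpa using (lt_of_not_ge (by simpa using hz) : R < ‖z‖).le)
  obtain ⟨C, hC⟩ := ((isCompact_closedBall s₀ 1).prod
    (isCompact_closedBall (0 : ESp d) R)).exists_bound_of_continuousOn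
    (f := fun p : ℝ × ESp d => w p.2 * K' p.1 p.2)
    ((hw.comp continuous_snd).mul hK').continuousOn
  have hs₀ : s₀ ∈ ball s₀ 1 := mem_ball_self one_pos
  refine (hasDerivAt_integral_of_dominated_loc_of_deriv_le
    (bound := (closedBall (0 : ESp d) R).indicator fun _ => C)
    (ball_mem_nhds s₀ one_pos) (Eventually.of_forall fun s => (hw.mul (hK s)).aestronglyMeasurable)
    ((hw.mul (hK s₀)).integrable_of_hasCompactSupport
      (hsub fun z hz => by simp [hsupp s₀ hs₀ z hz]))
    (hw.mul (hK'.comp (Continuous.prodMk_right s₀))).aestronglyMeasurable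
    (Eventually.of_forall fun z s hs => ?_) ?_
    (Eventually.of_forall fun z s _ => (h s z).const_mul (w z))).2
  · by_cases hz : z ∈ closedBall (0 : ESp d) R
    · rw [indicator_of_mem hz]
      exact hC (s, z) ⟨ball_subset_closedBall hs, hz⟩
    · rw [indicator_of_notMem hz, hsupp' s hs z (by
        simpa using (lt_of_not_ge (by simpa using hz) : R < ‖z‖).le)]
      simp
  · exact (integrable_indicator_iff measurableSet_closedBall).2
      (integrableOn_const (isCompact_closedBall _ _).measure_lt_top.ne)

theorem pd_comp_sub (u : ESp d → ℝ) (x : ESp d) (i : Fin (d + 2)) (z : ESp d) :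
    pd i (fun y => u (y - x)) z = pd i u (z - x) := by
  simp only [pd]
  rw [fderiv_comp_sub]

theorem lapE_comp_sub (u : ESp d → ℝ) (x z : ESp d) :
    lapE (fun y => u (y - x)) z = lapE u (z - x) := by
  change ∑ i, pd i (pd i (fun y => u (y - x))) z = ∑ i, pd i (pd i u) (z - x)
  refine Finset.sum_congr rfl fun i _ => ?_
  rw [show pd i (fun y => u (y - x)) = fun z => pd i u (z - x) from
    funext (pd_comp_sub u x i), pd_comp_sub (pd i u)]

/-- A continuous weakly harmonic function agrees with its averages against a radial bump. -/
theorem exists_integral_radial_eq {u : ESp d → ℝ} (hu : Continuous u)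
    (hweak : ∀ Ψ : ESp d → ℝ, ContDiff ℝ 2 Ψ → HasCompactSupport Ψ → ∫ z, u z * lapE Ψ z = 0)
    (η : ContDiffBump (0 : ℝ)) (x : ESp d) :
    u x * ∫ y : ESp d, η (‖y‖ ^ 2) = ∫ y, u (x + y) * η (‖y‖ ^ 2) := by
  have hη : ContDiff ℝ 1 η := η.contDiff
  have hηd : ∀ t, HasDerivAt η (deriv η t) t := fun t =>
    (hη.differentiable one_ne_zero t).hasDerivAt
  have hη' : Continuous (deriv η) := hη.continuous_deriv le_rfl
  set b := η.rOut with hb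
  have hb0 : 0 < b := η.rOut_pos
  have hηz : ∀ t, b ≤ t → η t = 0 := fun t ht =>
    η.zero_of_le_dist (by simpa [abs_of_nonneg (hb0.le.trans ht)] using ht)
  set G : ℝ → ℝ := fun t => ∫ r in b..t, η r with hG
  have hGd : ∀ t, HasDerivAt G (η t) t := fun t =>
    intervalIntegral.integral_hasDerivAt_right (hη.continuous.intervalIntegrable _ _)
      hη.continuous.aestronglyMeasurable.stronglyMeasurableAtFilter hη.continuous.continuousAt
  have hGz : ∀ t, b ≤ t → G t = 0 := fun t ht => by
    simp only [hG]
    rw [intervalIntegral.integral_congr (g := fun _ => 0)]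
    · simp
    · intro r hr
      rw [uIcc_of_le ht] at hr
      exact hηz r hr.1
  set K : ℝ → ESp d → ℝ := fun s z =>
    Real.exp (-((d + 2) * s)) * η (Real.exp (-(2 * s)) * ‖z‖ ^ 2) with hK
  set K' : ℝ → ESp d → ℝ := fun s z => -(Real.exp (-((d + 2) * s)) *
    ((d + 2) * η (Real.exp (-(2 * s)) * ‖z‖ ^ 2) + 2 * Real.exp (-(2 * s)) * ‖z‖ ^ 2 *
      deriv η (Real.exp (-(2 * s)) * ‖z‖ ^ 2))) with hK'
  have hKc : ∀ s, Continuous (K s) := fun s => by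
    have := hη.continuous
    simp only [hK]
    fun_prop
  have hK'c : Continuous K'.uncurry := by
    have := hη.continuous
    simp only [hK', Function.uncurry_def]
    fun_prop
  have hder : ∀ s z, HasDerivAt (K · z) (K' s z) s := fun s z => by
    have h1 : HasDerivAt (fun s : ℝ => Real.exp (-((d + 2) * s)))
        (Real.exp (-((d + 2) * s)) * -((d + 2) * 1)) s :=
      ((hasDerivAt_id s).const_mul _).neg.exp
    have h2 : HasDerivAt (fun s : ℝ => Real.exp (-(2 * s)) * ‖z‖ ^ 2)
        (Real.exp (-(2 * s)) * -(2 * 1) * ‖z‖ ^ 2) s :=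
      ((hasDerivAt_id s).const_mul _).neg.exp.mul_const _
    refine (h1.mul ((hηd _).comp s h2)).congr_deriv ?_
    simp only [hK', Function.comp]
    ring
  have hw : Continuous fun z => u (x + z) := by fun_prop
  have hm : ∀ s₀, HasDerivAt (fun s => ∫ z, u (x + z) * K s z) 0 s₀ := fun s₀ => by
    refine (hasDerivAt_integral_mul_kernel hw hKc hK'c hder
      (R := (b + 1) * Real.exp (s₀ + 1)) fun s hs z hz => ?_).congr_deriv ?_
    · have hs' : s ≤ s₀ + 1 := by
        rw [mem_ball, Real.dist_eq] at hs
        linarith [(abs_lt.1 hs).2]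
      have h1 : ((b + 1) * Real.exp s) ^ 2 ≤ ‖z‖ ^ 2 := by
        refine pow_le_pow_left₀ (by positivity) (le_trans ?_ hz) 2
        gcongr
      have h2 : b ≤ Real.exp (-(2 * s)) * ‖z‖ ^ 2 := by
        calc b ≤ (b + 1) ^ 2 := by nlinarith
          _ = Real.exp (-(2 * s)) * ((b + 1) * Real.exp s) ^ 2 := by
            rw [mul_pow, ← Real.exp_nat_mul, mul_left_comm, ← Real.exp_add]
            simp
          _ ≤ _ := by gcongr
      simp only [hK, hηz _ h2, mul_zero]
    · set a := Real.exp (-(2 * s₀)) with ha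
      have ha0 : 0 < a := Real.exp_pos _
      set Ψ : ESp d → ℝ := fun y => G (a * ‖y - x‖ ^ 2) with hΨ
      have hlap : ∀ z, lapE Ψ (x + z) = lapE (fun y => G (a * ‖y‖ ^ 2)) z := fun z => by
        rw [hΨ, lapE_comp_sub (fun y => G (a * ‖y‖ ^ 2)), add_sub_cancel_left]
      have hK'Ψ : ∀ z, u (x + z) * K' s₀ z =
          -(Real.exp (-((d + 2) * s₀)) / (2 * a)) * (u (x + z) * lapE Ψ (x + z)) := fun z => by
        rw [hlap, lapE_radial hη hGd]
        simp only [hK', ← ha]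
        field_simp
      simp only [hK'Ψ]
      rw [integral_const_mul, integral_add_left_eq_self (fun z => u z * lapE Ψ z), hweak, mul_zero]
      · exact (contDiff_two_of_deriv hη hGd).comp
          (contDiff_const.mul ((contDiff_norm_sq ℝ).comp (contDiff_id.sub contDiff_const)))
      · refine HasCompactSupport.intro (isCompact_closedBall x (Real.sqrt (b / a))) fun z hz => ?_
        refine hGz _ ?_
        rw [mem_closedBall, not_le, dist_eq_norm] at hz
        rw [Real.sqrt_lt' ((Real.sqrt_nonneg _).trans_lt hz), div_lt_iff₀ ha0] at hz
        linarith
  set M : ℝ → ℝ := fun ε => ∫ y : ESp d, u (x + ε • y) * η (‖y‖ ^ 2) with hM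
  have hMc : Continuous M := by
    have hc : Continuous fun p : ℝ × ESp d => u (x + p.1 • p.2) * η (‖p.2‖ ^ 2) := by
      have := hη.continuous
      fun_prop
    have hset : M = fun ε => ∫ y in closedBall (0 : ESp d) (b + 1),
        u (x + ε • y) * η (‖y‖ ^ 2) := funext fun ε =>
      (setIntegral_eq_integral_of_forall_compl_eq_zero fun y hy => by
        rw [mem_closedBall, not_le, dist_zero_right] at hy
        rw [hηz _ (by nlinarith), mul_zero]).symm
    rw [hset]
    exact continuous_parametric_integral_of_continuous
      (f := fun (ε : ℝ) (y : ESp d) => u (x + ε • y) * η (‖y‖ ^ 2)) hc (isCompact_closedBall _ _)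
  have hMm : ∀ s, M (Real.exp s) = ∫ z, u (x + z) * K s z := fun s => by
    have h := Measure.integral_comp_smul_of_nonneg (volume : Measure (ESp d))
      (fun z => u (x + z) * K s z) (Real.exp s) (hR := (Real.exp_pos s).le)
    rw [finrank_euclideanSpace_fin, ← Real.exp_nat_mul, smul_eq_mul,
      eq_inv_mul_iff_mul_eq₀ (Real.exp_pos _).ne', ← integral_const_mul] at h
    rw [← h]
    refine integral_congr_ae (Eventually.of_forall fun y => ?_)
    have h1 : Real.exp (-(2 * s)) * ‖Real.exp s • y‖ ^ 2 = ‖y‖ ^ 2 := by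
      rw [norm_smul, mul_pow, Real.norm_of_nonneg (Real.exp_pos s).le, ← Real.exp_nat_mul,
        ← mul_assoc, ← Real.exp_add]
      simp
    have h2 : Real.exp (↑(d + 2) * s) * Real.exp (-((d + 2) * s)) = 1 := by
      rw [← Real.exp_add]
      simp
    simp only [hK, h1]
    linear_combination (-(u (x + Real.exp s • y) * η (‖y‖ ^ 2))) * h2
  have hconst : ∀ s, M (Real.exp s) = M 1 := fun s => by
    rw [← Real.exp_zero, hMm, hMm]
    exact is_const_of_deriv_eq_zero (fun s => (hm s).differentiableAt) (fun s => (hm s).deriv) s 0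
  have hlim : M 0 = M 1 := tendsto_nhds_unique
    ((hMc.tendsto 0).comp Real.tendsto_exp_atBot)
    (tendsto_const_nhds.congr fun s => (hconst s).symm)
  simp only [hM, zero_smul, add_zero, one_smul] at hlim
  rw [← hlim, integral_const_mul]

/-- Weyl's lemma for continuous functions. -/
theorem contDiff_of_weakly_harmonic {u : ESp d → ℝ} (hu : Continuous u)
    (hweak : ∀ Ψ : ESp d → ℝ, ContDiff ℝ 2 Ψ → HasCompactSupport Ψ → ∫ z, u z * lapE Ψ z = 0) :
    ContDiff ℝ 2 u := by
  set η : ContDiffBump (0 : ℝ) := ⟨1, 2, one_pos, one_lt_two⟩ with hηdef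
  set ρ : ESp d → ℝ := fun y => η (‖y‖ ^ 2) with hρ
  have hρc : ContDiff ℝ 2 ρ := η.contDiff.comp (contDiff_norm_sq ℝ)
  have hρs : HasCompactSupport ρ := by
    refine HasCompactSupport.intro (isCompact_closedBall (0 : ESp d) 2) fun y hy => ?_
    rw [mem_closedBall, not_le, dist_zero_right] at hy
    refine η.zero_of_le_dist ?_
    rw [dist_zero_right, Real.norm_of_nonneg (by positivity)]
    change 2 ≤ _
    nlinarith
  have hpos : 0 < ∫ y, ρ y := by
    refine hρc.continuous.integral_pos_of_hasCompactSupport_nonneg_nonzero hρs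
      (fun y => η.nonneg) (x := 0) ?_
    have : η 0 = 1 := η.one_of_mem_closedBall (mem_closedBall_self η.rIn_pos.le)
    simp [hρ, this]
  have hconv : u = fun x => (∫ y, ρ y)⁻¹ * (ρ ⋆[ContinuousLinearMap.mul ℝ ℝ, volume] u) x := by
    funext x
    rw [eq_inv_mul_iff_mul_eq₀ hpos.ne', mul_comm, exists_integral_radial_eq hu hweak η x,
      convolution_def, ← integral_neg_eq_self]
    refine integral_congr_ae (Eventually.of_forall fun y => ?_)
    simp [hρ, mul_comm, sub_eq_add_neg]
  rw [hconv]
  exact contDiff_const.mul (hρs.contDiff_convolution_left _ hρc hu.locallyIntegrable)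

/-- The reflection in the hyperplane `{z 0 = 0}`. -/
def reflect (d : ℕ) : ESp d ≃ₗᵢ[ℝ] ESp d :=
  LinearIsometryEquiv.piLpCongrRight 2 fun i =>
    if i = 0 then LinearIsometryEquiv.neg ℝ else LinearIsometryEquiv.refl ℝ ℝ

theorem reflect_apply (z : ESp d) (i : Fin (d + 2)) :
    reflect d z i = if i = 0 then -z i else z i := by
  by_cases h : i = 0 <;> simp [reflect, h]

@[simp]
theorem reflect_apply_zero (z : ESp d) : reflect d z 0 = -z 0 := by simp [reflect_apply]

@[simp]
theorem reflect_reflect (z : ESp d) : reflect d (reflect d z) = z := by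
  ext i
  by_cases h : i = 0 <;> simp [reflect_apply, h]

theorem reflect_of_apply_zero {z : ESp d} (hz : z 0 = 0) : reflect d z = z := by
  ext i
  by_cases h : i = 0 <;> simp [reflect_apply, h, hz]

theorem reflect_single (i : Fin (d + 2)) : reflect d (EuclideanSpace.single i 1) =
    (if i = 0 then (-1 : ℝ) else 1) • EuclideanSpace.single i 1 := by
  ext j
  by_cases h : j = i <;> by_cases hi : i = 0 <;> by_cases hj : j = 0 <;>
    simp_all [reflect_apply]

theorem pd_comp_reflect (u : ESp d → ℝ) (i : Fin (d + 2)) (z : ESp d) :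
    pd i (fun y => u (reflect d y)) z = (if i = 0 then -1 else 1) * pd i u (reflect d z) := by
  have h := (reflect d).toContinuousLinearEquiv.comp_right_fderiv (f := u) (x := z)
  change fderiv ℝ (fun y => u (reflect d y)) z = _ at h
  simp only [pd, h]
  change fderiv ℝ u (reflect d z) (reflect d (EuclideanSpace.single i 1)) = _
  rw [reflect_single, map_smul, smul_eq_mul]

theorem lapE_comp_reflect (u : ESp d → ℝ) (z : ESp d) :
    lapE (fun y => u (reflect d y)) z = lapE u (reflect d z) := by
  change ∑ i, pd i (pd i (fun y => u (reflect d y))) z = ∑ i, pd i (pd i u) (reflect d z)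
  refine Finset.sum_congr rfl fun i _ => ?_
  rw [show pd i (fun y => u (reflect d y)) =
    fun z => (if i = 0 then -1 else 1) * pd i u (reflect d z) from
    funext (pd_comp_reflect u i), pd_const_mul (fun y => pd i u (reflect d y)),
    pd_comp_reflect (pd i u)]
  split_ifs <;> ring

theorem gradSqE_comp_reflect (u : ESp d → ℝ) (z : ESp d) :
    gradSqE (fun y => u (reflect d y)) z = gradSqE u (reflect d z) := by
  change ∑ i, pd i (fun y => u (reflect d y)) z ^ 2 = ∑ i, pd i u (reflect d z) ^ 2
  refine Finset.sum_congr rfl fun i _ => ?_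
  rw [pd_comp_reflect]
  split_ifs <;> ring

theorem lapE_const_mul (u : ESp d → ℝ) (c : ℝ) (z : ESp d) :
    lapE (fun y => c * u y) z = c * lapE u z := by
  change ∑ i, pd i (pd i (fun y => c * u y)) z = c * ∑ i, pd i (pd i u) z
  rw [Finset.mul_sum]
  refine Finset.sum_congr rfl fun i _ => ?_
  rw [show pd i (fun y => c * u y) = fun z => c * pd i u z from
    funext (pd_const_mul u c i), pd_const_mul (pd i u)]

theorem pd_congr_of_eventuallyEq {f g : ESp d → ℝ} {z : ESp d} (h : f =ᶠ[𝓝 z] g)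
    (i : Fin (d + 2)) : pd i f =ᶠ[𝓝 z] pd i g := by
  filter_upwards [h.fderiv (𝕜 := ℝ)] with y hy
  simp only [pd, hy]

theorem lapE_congr_of_eventuallyEq {f g : ESp d → ℝ} {z : ESp d} (h : f =ᶠ[𝓝 z] g) :
    lapE f z = lapE g z := by
  change ∑ i, pd i (pd i f) z = ∑ i, pd i (pd i g) z
  exact Finset.sum_congr rfl fun i _ =>
    (pd_congr_of_eventuallyEq (pd_congr_of_eventuallyEq h i) i).eq_of_nhds

theorem gradSqE_congr_of_eventuallyEq {f g : ESp d → ℝ} {z : ESp d} (h : f =ᶠ[𝓝 z] g) :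
    gradSqE f z = gradSqE g z := by
  change ∑ i, pd i f z ^ 2 = ∑ i, pd i g z ^ 2
  exact Finset.sum_congr rfl fun i _ => by rw [(pd_congr_of_eventuallyEq h i).eq_of_nhds]

theorem mem_halfSpace {z : ESp d} : z ∈ HalfSpace d ↔ 0 < z 0 := Iff.rfl

theorem isOpen_halfSpace : IsOpen (HalfSpace d) :=
  isOpen_lt continuous_const (EuclideanSpace.proj (0 : Fin (d + 2)) : ESp d →L[ℝ] ℝ).continuous

theorem closure_halfSpace_coord_zero : closure (HalfSpace d) = {z : ESp d | 0 ≤ z 0} :=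
  closure_open_halfSpace 2 0 0

theorem dense_apply_zero_ne : Dense {z : ESp d | z 0 ≠ 0} := fun z => by
  by_cases hz : z 0 = 0
  · refine closure_mono (fun (y : ESp d) hy => ne_of_gt (mem_halfSpace.1 hy))
      (?_ : z ∈ closure (HalfSpace d))
    rw [closure_halfSpace_coord_zero]
    exact hz.ge
  · exact subset_closure hz

/-- The odd extension of a function on the half-space. -/
def oddExt (v : ESp d → ℝ) (z : ESp d) : ℝ := if 0 ≤ z 0 then v z else -v (reflect d z)

theorem oddExt_of_nonneg (v : ESp d → ℝ) {z : ESp d} (hz : 0 ≤ z 0) : oddExt v z = v z :=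
  if_pos hz

theorem oddExt_eventuallyEq (v : ESp d → ℝ) {z : ESp d} (hz : z ∈ HalfSpace d) :
    oddExt v =ᶠ[𝓝 z] v := by
  filter_upwards [isOpen_halfSpace.mem_nhds hz] with y hy using oddExt_of_nonneg v (le_of_lt hy)

theorem oddExt_reflect {v : ESp d → ℝ} (hbd : ∀ z : ESp d, z 0 = 0 → v z = 0) (z : ESp d) :
    oddExt v (reflect d z) = -oddExt v z := by
  rcases lt_trichotomy (z 0) 0 with h | h | h
  · simp [oddExt, h.le, h.not_ge]
  · rw [reflect_of_apply_zero h, oddExt_of_nonneg v h.ge, hbd z h, neg_zero]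
  · simp [oddExt, h.le, h.not_ge]

theorem continuous_oddExt {v : ESp d → ℝ} (hcont : ContinuousOn v (closure (HalfSpace d)))
    (hbd : ∀ z : ESp d, z 0 = 0 → v z = 0) : Continuous (oddExt v) := by
  have hc0 : Continuous fun z : ESp d => z 0 :=
    (EuclideanSpace.proj (0 : Fin (d + 2)) : ESp d →L[ℝ] ℝ).continuous
  rw [closure_halfSpace_coord_zero] at hcont
  refine continuous_if_le continuous_const hc0 hcont ?_ ?_
  · refine (hcont.comp (reflect d).continuous.continuousOn fun z hz => ?_).neg
    have : z 0 ≤ 0 := hz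
    simpa using this
  · intro z hz
    rw [reflect_of_apply_zero hz.symm, hbd z hz.symm, neg_zero]

theorem oddExt_eventuallyEq_neg {v : ESp d → ℝ} (hbd : ∀ z : ESp d, z 0 = 0 → v z = 0) {z : ESp d}
    (hz : z 0 < 0) : oddExt v =ᶠ[𝓝 z] fun y => -1 * v (reflect d y) := by
  have h : reflect d z ∈ HalfSpace d := by
    rw [mem_halfSpace]
    simpa using hz
  filter_upwards [(reflect d).continuous.continuousAt.preimage_mem_nhds
    (isOpen_halfSpace.mem_nhds h)] with y hy
  rw [neg_one_mul, ← oddExt_of_nonneg v (le_of_lt hy), oddExt_reflect hbd, neg_neg]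

theorem lapE_oddExt {v : ESp d → ℝ} (hbd : ∀ z : ESp d, z 0 = 0 → v z = 0)
    (hharm : ∀ z ∈ HalfSpace d, lapE v z = 0) {z : ESp d} (hz : z 0 ≠ 0) :
    lapE (oddExt v) z = 0 := by
  rcases hz.lt_or_gt with h | h
  · rw [lapE_congr_of_eventuallyEq (oddExt_eventuallyEq_neg hbd h),
      lapE_const_mul (fun y => v (reflect d y)), lapE_comp_reflect, hharm, mul_zero]
    rw [mem_halfSpace]
    simpa using h
  · rw [lapE_congr_of_eventuallyEq (oddExt_eventuallyEq v h), hharm z h]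

theorem contDiffAt_oddExt {v : ESp d → ℝ} (hbd : ∀ z : ESp d, z 0 = 0 → v z = 0)
    (hC2 : ContDiffOn ℝ 2 v (HalfSpace d)) {z : ESp d} (hz : z 0 ≠ 0) :
    ContDiffAt ℝ 2 (oddExt v) z := by
  have hat : ∀ y ∈ HalfSpace d, ContDiffAt ℝ 2 v y := fun y hy =>
    hC2.contDiffAt (isOpen_halfSpace.mem_nhds hy)
  rcases hz.lt_or_gt with h | h
  · refine ContDiffAt.congr_of_eventuallyEq ?_ (oddExt_eventuallyEq_neg hbd h)
    refine contDiffAt_const.mul (ContDiffAt.comp z (hat _ ?_) (reflect d).contDiff.contDiffAt)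
    rw [mem_halfSpace]
    simpa using h
  · exact (hat z h).congr_of_eventuallyEq (oddExt_eventuallyEq v h)

theorem integrable_mul_of_tsupport_subset {f g : ESp d → ℝ} {U : Set (ESp d)} (hU : IsOpen U)
    (hf : ContinuousOn f U) (hg : Continuous g) (hs : HasCompactSupport g) (hsub : tsupport g ⊆ U) :
    Integrable fun x => f x * g x := by
  have hc : Continuous fun x => f x * g x :=
    (hf.mul hg.continuousOn).continuous_of_tsupport_subset hU
      ((tsupport_mul_subset_right (f := f)).trans hsub)
  exact hc.integrable_of_hasCompactSupport hs.mul_left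

theorem tsupport_pd_subset (f : ESp d → ℝ) (i : Fin (d + 2)) : tsupport (pd i f) ⊆ tsupport f :=
  tsupport_fderiv_apply_subset ℝ _

theorem HasCompactSupport.pd {f : ESp d → ℝ} (hf : HasCompactSupport f) (i : Fin (d + 2)) :
    HasCompactSupport (pd i f) :=
  hf.mono' (subset_closure.trans (tsupport_pd_subset f i))

/-- Green's second identity against test functions supported where `u` is harmonic. -/
theorem integral_mul_lapE_of_tsupport_subset {u Θ : ESp d → ℝ} {U : Set (ESp d)} (hU : IsOpen U)
    (hu : ContDiffOn ℝ 2 u U) (hlap : ∀ z ∈ U, lapE u z = 0) (hΘ : ContDiff ℝ 2 Θ)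
    (hs : HasCompactSupport Θ) (hsub : tsupport Θ ⊆ U) : ∫ z, u z * lapE Θ z = 0 := by
  have hat : ∀ z ∈ U, ContDiffAt ℝ 2 u z := fun z hz => hu.contDiffAt (hU.mem_nhds hz)
  have hpd : ∀ i, ∀ z ∈ U, ContDiffAt ℝ 1 (pd i u) z := fun i z hz =>
    ((hat z hz).fderiv_right (by norm_num)).clm_apply contDiffAt_const
  have hpd2 : ∀ i, ∀ z ∈ U, ContDiffAt ℝ 0 (pd i (pd i u)) z := fun i z hz =>
    ((hpd i z hz).fderiv_right (by norm_num)).clm_apply contDiffAt_const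
  have hu0 : ContinuousOn u U := hu.continuousOn
  have hu1 : ∀ i, ContinuousOn (pd i u) U := fun i z hz =>
    (hpd i z hz).continuousAt.continuousWithinAt
  have hu2 : ∀ i, ContinuousOn (pd i (pd i u)) U := fun i z hz =>
    (hpd2 i z hz).continuousAt.continuousWithinAt
  have hΘ1 : ∀ i, ContDiff ℝ 1 (pd i Θ) := fun i => hΘ.pd_contDiff (by norm_num) i
  have hΘ2 : ∀ i, ContDiff ℝ 0 (pd i (pd i Θ)) := fun i => (hΘ1 i).pd_contDiff (by norm_num) i
  have hsub1 : ∀ i, tsupport (pd i Θ) ⊆ U := fun i => (tsupport_pd_subset Θ i).trans hsub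
  have hsub2 : ∀ i, tsupport (pd i (pd i Θ)) ⊆ U := fun i =>
    (tsupport_pd_subset (pd i Θ) i).trans (hsub1 i)
  have key : ∀ i, ∫ z, u z * pd i (pd i Θ) z = ∫ z, pd i (pd i u) z * Θ z := fun i => by
    have h1 : ∫ z, u z * pd i (pd i Θ) z = -∫ z, pd i u z * pd i Θ z :=
      integral_mul_fderiv_eq_neg_fderiv_mul_of_integrable
        (integrable_mul_of_tsupport_subset hU (hu1 i) (hΘ1 i).continuous (hs.pd i) (hsub1 i))
        (integrable_mul_of_tsupport_subset hU hu0 (hΘ2 i).continuous ((hs.pd i).pd i) (hsub2 i))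
        (integrable_mul_of_tsupport_subset hU hu0 (hΘ1 i).continuous (hs.pd i) (hsub1 i))
        (fun z hz => (hat z (hsub1 i hz)).differentiableAt two_ne_zero)
        (fun z _ => (hΘ1 i).differentiable one_ne_zero z)
    have h2 : ∫ z, pd i u z * pd i Θ z = -∫ z, pd i (pd i u) z * Θ z :=
      integral_mul_fderiv_eq_neg_fderiv_mul_of_integrable
        (integrable_mul_of_tsupport_subset hU (hu2 i) hΘ.continuous hs hsub)
        (integrable_mul_of_tsupport_subset hU (hu1 i) (hΘ1 i).continuous (hs.pd i) (hsub1 i))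
        (integrable_mul_of_tsupport_subset hU (hu1 i) hΘ.continuous hs hsub)
        (fun z hz => (hpd i z (hsub hz)).differentiableAt one_ne_zero)
        (fun z _ => hΘ.differentiable two_ne_zero z)
    rw [h1, h2, neg_neg]
  have hexp : ∀ z, u z * lapE Θ z = ∑ i, u z * pd i (pd i Θ) z := fun z => Finset.mul_sum _ _ _
  have hexp' : ∀ z, ∑ i, pd i (pd i u) z * Θ z = 0 := fun z => by
    rw [← Finset.sum_mul]
    by_cases hz : z ∈ tsupport Θ
    · have : ∑ i, pd i (pd i u) z = 0 := hlap z (hsub hz)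
      rw [this, zero_mul]
    · rw [image_eq_zero_of_notMem_tsupport hz, mul_zero]
  simp only [hexp]
  rw [integral_finsetSum _ fun i _ => integrable_mul_of_tsupport_subset hU hu0 (hΘ2 i).continuous
    ((hs.pd i).pd i) (hsub2 i), Finset.sum_congr rfl fun i _ => key i,
    ← integral_finsetSum _ fun i _ => integrable_mul_of_tsupport_subset hU (hu2 i) hΘ.continuous
      hs hsub]
  simp only [hexp', integral_zero]

theorem lapE_mul {f g : ESp d → ℝ} (hf : ContDiff ℝ 2 f) (hg : ContDiff ℝ 2 g) (z : ESp d) :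
    lapE (fun y => f y * g y) z =
      f z * lapE g z + 2 * (∑ i, pd i f z * pd i g z) + lapE f z * g z := by
  change ∑ i, pd i (pd i (fun y => f y * g y)) z = f z * ∑ i, pd i (pd i g) z + _ +
    (∑ i, pd i (pd i f) z) * g z
  rw [Finset.mul_sum, Finset.mul_sum, Finset.sum_mul, ← Finset.sum_add_distrib,
    ← Finset.sum_add_distrib]
  refine Finset.sum_congr rfl fun i _ => ?_
  have hf0 := hf.differentiable two_ne_zero
  have hg0 := hg.differentiable two_ne_zero
  have hf1 : Differentiable ℝ (pd i f) :=
    (hf.pd_contDiff (m := 1) (by norm_num) i).differentiable one_ne_zero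
  have hg1 : Differentiable ℝ (pd i g) :=
    (hg.pd_contDiff (m := 1) (by norm_num) i).differentiable one_ne_zero
  have h1 : pd i (fun y => f y * g y) = fun y => f y * pd i g y + pd i f y * g y :=
    funext fun y => pd_mul (hf0 y) (hg0 y) i
  have h2 : pd i (fun y => f y * pd i g y + pd i f y * g y) z =
      pd i (fun y => f y * pd i g y) z + pd i (fun y => pd i f y * g y) z := by
    simp only [pd]
    rw [fderiv_fun_add]
    · rfl
    · exact (hf0 z).mul (hg1 z)
    · exact (hf1 z).mul (hg0 z)
  rw [h1, h2, pd_mul (hf0 z) (hg1 z), pd_mul (hf1 z) (hg0 z)]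
  ring

theorem lapE_add {f g : ESp d → ℝ} (hf : ContDiff ℝ 2 f) (hg : ContDiff ℝ 2 g) (z : ESp d) :
    lapE (fun y => f y + g y) z = lapE f z + lapE g z := by
  change ∑ i, pd i (pd i (fun y => f y + g y)) z = ∑ i, pd i (pd i f) z + ∑ i, pd i (pd i g) z
  rw [← Finset.sum_add_distrib]
  refine Finset.sum_congr rfl fun i _ => ?_
  have hf0 := hf.differentiable two_ne_zero
  have hg0 := hg.differentiable two_ne_zero
  have hf1 : Differentiable ℝ (pd i f) :=
    (hf.pd_contDiff (m := 1) (by norm_num) i).differentiable one_ne_zero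
  have hg1 : Differentiable ℝ (pd i g) :=
    (hg.pd_contDiff (m := 1) (by norm_num) i).differentiable one_ne_zero
  have h1 : pd i (fun y => f y + g y) = fun y => pd i f y + pd i g y :=
    funext fun y => by simp only [pd]; rw [fderiv_fun_add (hf0 y) (hg0 y)]; rfl
  rw [h1]
  simp only [pd] at hf1 hg1 ⊢
  rw [fderiv_fun_add (hf1 z) (hg1 z)]
  rfl

theorem ContDiff.contDiff_deriv {μ : ℝ → ℝ} (hμ : ContDiff ℝ 2 μ) : ContDiff ℝ 1 (deriv μ) := by
  rw [← one_add_one_eq_two, contDiff_succ_iff_deriv] at hμ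
  exact hμ.2.2

theorem pd_comp_coord {μ : ℝ → ℝ} (hμ : Differentiable ℝ μ) (a : ℝ) (i : Fin (d + 2)) (z : ESp d) :
    pd i (fun y => μ (a * y 0)) z = if i = 0 then a * deriv μ (a * z 0) else 0 := by
  have h1 : HasFDerivAt (fun y : ESp d => a * y 0)
      (a • (EuclideanSpace.proj 0 : ESp d →L[ℝ] ℝ)) z :=
    (EuclideanSpace.proj 0 : ESp d →L[ℝ] ℝ).hasFDerivAt.const_mul a
  have h2 := (hμ (a * z 0)).hasDerivAt.comp_hasFDerivAt z h1
  rw [pd, show (fun y : ESp d => μ (a * y 0)) = μ ∘ fun y => a * y 0 from rfl, h2.fderiv]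
  by_cases hi : i = 0
  · simp [hi, mul_comm]
  · simp [hi, Ne.symm hi]

theorem lapE_comp_coord {μ : ℝ → ℝ} (hμ : ContDiff ℝ 2 μ) (a : ℝ) (z : ESp d) :
    lapE (fun y => μ (a * y 0)) z = a ^ 2 * deriv (deriv μ) (a * z 0) := by
  change ∑ i, pd i (pd i (fun y => μ (a * y 0))) z = _
  have hμ1 : Differentiable ℝ μ := hμ.differentiable two_ne_zero
  have hμ2 : Differentiable ℝ (deriv μ) := hμ.contDiff_deriv.differentiable one_ne_zero
  rw [Finset.sum_eq_single 0]
  · rw [show pd 0 (fun y : ESp d => μ (a * y 0)) = fun y => a * deriv μ (a * y 0) from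
      funext fun y => by rw [pd_comp_coord hμ1, if_pos rfl],
      pd_const_mul (fun y : ESp d => deriv μ (a * y 0)), pd_comp_coord hμ2, if_pos rfl]
    ring
  · intro i _ hi
    rw [show pd i (fun y : ESp d => μ (a * y 0)) = fun _ => 0 from
      funext fun y => by rw [pd_comp_coord hμ1, if_neg hi]]
    simp [pd]
  · simp

theorem sub_reflect (z : ESp d) : z - reflect d z = (2 * z 0) • EuclideanSpace.single 0 1 := by
  ext i
  by_cases h : i = 0
  · subst h
    simp
    ring
  · simp [reflect_apply, h]

theorem dist_reflect (z : ESp d) : dist z (reflect d z) = 2 * |z 0| := by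
  rw [dist_eq_norm, sub_reflect, norm_smul]
  simp

theorem measureReal_slab_le {M δ : ℝ} (hM : 0 ≤ M) (hδ : 0 ≤ δ) :
    (volume : Measure (ESp d)).real {z | |z 0| ≤ δ ∧ ‖z‖ ≤ M} ≤ 2 * δ * (2 * M) ^ (d + 1) := by
  set c : Fin (d + 2) → ℝ := fun i => if i = 0 then δ else M with hc
  have hvol : (volume : Measure (Fin (d + 2) → ℝ)).real (Icc (-c) c) =
      2 * δ * (2 * M) ^ (d + 1) := by
    rw [Measure.real, Real.volume_Icc_pi_toReal]
    · rw [Fin.prod_univ_succ]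
      simp [hc, Fin.succ_ne_zero]
      ring
    · intro i
      simp only [Pi.neg_apply, hc]
      split_ifs <;> linarith
  rw [← hvol, Measure.real, Measure.real, ← (PiLp.volume_preserving_ofLp
    (Fin (d + 2))).measure_preimage measurableSet_Icc.nullMeasurableSet]
  refine ENNReal.toReal_mono ?_ (measure_mono fun z hz => ?_)
  · rw [(PiLp.volume_preserving_ofLp
      (Fin (d + 2))).measure_preimage measurableSet_Icc.nullMeasurableSet]
    exact isCompact_Icc.measure_lt_top.ne
  · have hi : ∀ i, |z i| ≤ c i := fun i => by
      simp only [hc]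
      split_ifs with h
      · rw [h]; exact hz.1
      · exact (PiLp.norm_apply_le z i).trans hz.2
    exact ⟨fun i => (abs_le.1 (hi i)).1, fun i => (abs_le.1 (hi i)).2⟩

theorem ContDiff.continuous_lapE {f : ESp d → ℝ} (hf : ContDiff ℝ 2 f) : Continuous (lapE f) :=
  continuous_finsetSum _ fun i _ =>
    ((hf.pd_contDiff (m := 1) (by norm_num) i).pd_contDiff (m := 0) (by norm_num) i).continuous

theorem lapE_eq_zero_of_forall_compl {f : ESp d → ℝ} {S : Set (ESp d)} (hS : IsClosed S)
    (h : ∀ z ∉ S, f z = 0) {z : ESp d} (hz : z ∉ S) : lapE f z = 0 := by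
  have h0 : f =ᶠ[𝓝 z] fun _ => 0 := by
    filter_upwards [hS.isOpen_compl.mem_nhds hz] with y hy using h y hy
  rw [lapE_congr_of_eventuallyEq h0]
  simp [lapE]

theorem HasCompactSupport.lapE {f : ESp d → ℝ} (hf : HasCompactSupport f) :
    HasCompactSupport (lapE f) :=
  HasCompactSupport.intro hf fun _ hz => lapE_eq_zero_of_forall_compl (isClosed_tsupport f)
    (fun _ hy => image_eq_zero_of_notMem_tsupport hy) hz

theorem continuous_coord_zero : Continuous fun z : ESp d => z 0 :=
  (EuclideanSpace.proj 0 : ESp d →L[ℝ] ℝ).continuous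

/-- The Laplacian of an odd function cut off to a slab of width of order `1 / a` is of order `a`. -/
theorem exists_abs_lapE_cutoff_le {μ : ℝ → ℝ} (hμ : ContDiff ℝ 2 μ) (hμ1 : ∀ t, |μ t| ≤ 1)
    (hμs : HasCompactSupport μ) {ψ : ESp d → ℝ} (hψ : ContDiff ℝ 2 ψ) (hs : HasCompactSupport ψ)
    (hodd : ∀ z, ψ (reflect d z) = -ψ z) :
    ∃ C, ∀ a : ℝ, 1 ≤ a → ∀ z, |a * z 0| ≤ 2 →
      |lapE (fun y => μ (a * y 0) * ψ y) z| ≤ C * a := by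
  obtain ⟨B₀, hB₀⟩ := hs.lapE.exists_bound_of_continuous hψ.continuous_lapE
  obtain ⟨B₁, hB₁⟩ := (hs.pd 0).exists_bound_of_continuous
    (hψ.pd_contDiff (m := 1) (by norm_num) 0).continuous
  obtain ⟨C₁, hC₁⟩ := hμs.deriv.exists_bound_of_continuous hμ.contDiff_deriv.continuous
  obtain ⟨C₂, hC₂⟩ := hμs.deriv.deriv.exists_bound_of_continuous
    (hμ.contDiff_deriv.continuous_deriv le_rfl)
  obtain ⟨L, hL⟩ := hψ.lipschitzWith_of_hasCompactSupport hs two_ne_zero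
  simp only [Real.norm_eq_abs] at hB₀ hB₁ hC₁ hC₂
  have hψL : ∀ z, |ψ z| ≤ L * |z 0| := fun z => by
    have h := hL.dist_le_mul z (reflect d z)
    rw [dist_reflect, hodd, Real.dist_eq, sub_neg_eq_add, ← two_mul, abs_mul, abs_two] at h
    linarith
  refine ⟨B₀ + 2 * (C₁ * B₁) + C₂ * (2 * L), fun a ha z hz => ?_⟩
  have ha0 : 0 < a := one_pos.trans_le ha
  have hc : ContDiff ℝ 2 fun y : ESp d => μ (a * y 0) :=
    hμ.comp (contDiff_const.mul (EuclideanSpace.proj 0 : ESp d →L[ℝ] ℝ).contDiff)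
  have hcross : ∑ i, pd i (fun y : ESp d => μ (a * y 0)) z * pd i ψ z =
      a * deriv μ (a * z 0) * pd 0 ψ z := by
    rw [Finset.sum_eq_single 0]
    · rw [pd_comp_coord (hμ.differentiable two_ne_zero), if_pos rfl]
    · intro i _ hi
      rw [pd_comp_coord (hμ.differentiable two_ne_zero), if_neg hi, zero_mul]
    · simp
  rw [lapE_mul hc hψ, hcross, lapE_comp_coord hμ]
  have h1 : |μ (a * z 0) * lapE ψ z| ≤ B₀ * a := by
    rw [abs_mul]
    have hB := hB₀ z
    calc _ ≤ 1 * B₀ := mul_le_mul (hμ1 _) hB (abs_nonneg _) zero_le_one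
      _ ≤ B₀ * a := by nlinarith [(abs_nonneg _).trans hB]
  have h2 : |2 * (a * deriv μ (a * z 0) * pd 0 ψ z)| ≤ 2 * (C₁ * B₁) * a := by
    rw [abs_mul, abs_mul, abs_mul, abs_two, abs_of_pos ha0]
    have := mul_le_mul (hC₁ (a * z 0)) (hB₁ z) (abs_nonneg _) ((abs_nonneg _).trans (hC₁ (a * z 0)))
    nlinarith
  have h3 : |a ^ 2 * deriv (deriv μ) (a * z 0) * ψ z| ≤ C₂ * (2 * L) * a := by
    have hψ2 : a * |ψ z| ≤ 2 * L := by
      have hz' : a * |z 0| ≤ 2 := by rwa [abs_mul, abs_of_pos ha0] at hz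
      calc a * |ψ z| ≤ a * (L * |z 0|) := by gcongr; exact hψL z
        _ = L * (a * |z 0|) := by ring
        _ ≤ L * 2 := by gcongr
        _ = 2 * L := mul_comm _ _
    rw [abs_mul, abs_mul, abs_of_pos (by positivity)]
    have := mul_le_mul (hC₂ (a * z 0)) hψ2 (by positivity)
      ((abs_nonneg _).trans (hC₂ (a * z 0)))
    nlinarith
  calc _ ≤ _ := (abs_add_le _ _).trans (add_le_add_left (abs_add_le _ _) _)
    _ ≤ _ := add_le_add (add_le_add h1 h2) h3
    _ = _ := by ring

theorem integral_mul_lapE_of_odd {u : ESp d → ℝ} (hu : Continuous u)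
    (huodd : ∀ z, u (reflect d z) = -u z) (hu2 : ∀ z : ESp d, z 0 ≠ 0 → ContDiffAt ℝ 2 u z)
    (hlap : ∀ z : ESp d, z 0 ≠ 0 → lapE u z = 0) {ψ : ESp d → ℝ} (hψ : ContDiff ℝ 2 ψ)
    (hs : HasCompactSupport ψ) (hodd : ∀ z, ψ (reflect d z) = -ψ z) :
    ∫ z, u z * lapE ψ z = 0 := by
  set μ : ContDiffBump (0 : ℝ) := ⟨1, 2, one_pos, one_lt_two⟩ with hμdef
  have hμ : ContDiff ℝ 2 μ := μ.contDiff
  obtain ⟨C, hC⟩ := exists_abs_lapE_cutoff_le hμ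
    (fun t => abs_le.2 ⟨by linarith [μ.nonneg (x := t)], μ.le_one⟩) μ.hasCompactSupport hψ hs hodd
  obtain ⟨M, hM0, hM⟩ := hs.isCompact.isBounded.subset_closedBall_lt 0 0
  have hψM : ∀ z, M < ‖z‖ → ψ z = 0 := fun z hz => by
    refine image_eq_zero_of_notMem_tsupport fun h => ?_
    have := hM h
    rw [mem_closedBall, dist_zero_right] at this
    exact absurd this (not_le.2 hz)
  have hC0 : 0 ≤ C := by simpa using (abs_nonneg _).trans (hC 1 le_rfl 0 (by simp))
  set D := 4 * C * (2 * M) ^ (d + 1) with hD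
  have hD0 : 0 ≤ D := by positivity
  have key : ∀ ε : ℝ, 0 < ε → |∫ z, u z * lapE ψ z| ≤ ε * D := fun ε hε => by
    obtain ⟨δ, hδ, hδu⟩ := Metric.uniformContinuousOn_iff.1
      ((isCompact_closedBall (0 : ESp d) M).uniformContinuousOn_of_continuous hu.continuousOn) ε hε
    set a := max 1 (5 / δ) with ha
    have ha1 : 1 ≤ a := le_max_left _ _
    have ha0 : 0 < a := one_pos.trans_le ha1
    have haδ : 5 ≤ a * δ := (div_le_iff₀ hδ).1 (le_max_right _ _)
    set S : Set (ESp d) := {z | |z 0| ≤ 2 / a ∧ ‖z‖ ≤ M} with hSdef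
    have hS : IsClosed S := (isClosed_le continuous_coord_zero.abs continuous_const).inter
      (isClosed_le continuous_norm continuous_const)
    have hSfin : volume S < ⊤ := (measure_mono fun z (hz : z ∈ S) => by
      simpa using hz.2).trans_lt (isCompact_closedBall (0 : ESp d) M).measure_lt_top
    set Φ : ESp d → ℝ := fun y => μ (a * y 0) * ψ y with hΦdef
    set Θ : ESp d → ℝ := fun y => (1 - μ (a * y 0)) * ψ y with hΘdef
    have hcut : ContDiff ℝ 2 fun y : ESp d => μ (a * y 0) :=
      hμ.comp (contDiff_const.mul (EuclideanSpace.proj 0 : ESp d →L[ℝ] ℝ).contDiff)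
    have hΦ : ContDiff ℝ 2 Φ := hcut.mul hψ
    have hΘ : ContDiff ℝ 2 Θ := (contDiff_const.sub hcut).mul hψ
    have hΦs : HasCompactSupport Φ := hs.mul_left
    have hΘs : HasCompactSupport Θ := hs.mul_left
    have hu_S : ∀ z ∈ S, |u z| ≤ ε := fun z hz => by
      have hz0 : a * |z 0| ≤ 2 := by
        have := hz.1
        rwa [le_div_iff₀ ha0, mul_comm] at this
      have h := hδu z (by simpa using hz.2) (reflect d z) (by simpa using hz.2) (by
        rw [dist_reflect]
        by_contra hcon
        nlinarith [mul_le_mul_of_nonneg_left (not_lt.1 hcon) ha0.le])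
      rw [huodd, Real.dist_eq, sub_neg_eq_add, ← two_mul, abs_mul, abs_two] at h
      linarith [abs_nonneg (u z)]
    have hΦ0 : ∀ z ∉ S, Φ z = 0 := fun z hz => by
      by_cases h0 : |z 0| ≤ 2 / a
      · have : ψ z = 0 := hψM z (not_le.1 fun h => hz ⟨h0, h⟩)
        simp [hΦdef, this]
      · have : μ (a * z 0) = 0 := by
          refine μ.zero_of_le_dist ?_
          rw [not_le, div_lt_iff₀ ha0] at h0
          rw [dist_zero_right, Real.norm_eq_abs, abs_mul, abs_of_pos ha0, mul_comm]
          exact h0.le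
        simp [hΦdef, this]
    have hΘsub : tsupport Θ ⊆ {z | z 0 ≠ 0} := by
      have hcl : IsClosed {z : ESp d | 1 ≤ |a * z 0|} :=
        isClosed_le continuous_const (continuous_const.mul continuous_coord_zero).abs
      refine (closure_minimal (fun z hz => ?_) hcl).trans fun z hz h0 => ?_
      · by_contra hcon
        refine hz ?_
        have : μ (a * z 0) = 1 := μ.one_of_mem_closedBall (by
          rw [mem_closedBall, dist_zero_right]
          exact (not_le.1 hcon).le)
        simp [hΘdef, this]
      · have h1 : (1 : ℝ) ≤ |a * z 0| := hz
        have h2 : z 0 = 0 := h0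
        rw [h2] at h1
        norm_num at h1
    have hopen : IsOpen {z : ESp d | z 0 ≠ 0} :=
      isOpen_ne_fun continuous_coord_zero continuous_const
    have hΘint := integral_mul_lapE_of_tsupport_subset hopen
      (fun z hz => (hu2 z hz).contDiffWithinAt) hlap hΘ hΘs hΘsub
    have hsum : ∀ z, u z * lapE ψ z = u z * lapE Θ z + u z * lapE Φ z := fun z => by
      have : ψ = fun y => Θ y + Φ y := funext fun y => by simp only [hΘdef, hΦdef]; ring
      conv_lhs => rw [this, lapE_add hΘ hΦ, mul_add]
    have hint : ∀ {f : ESp d → ℝ}, ContDiff ℝ 2 f → HasCompactSupport f →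
        Integrable fun z => u z * lapE f z := fun hf hfs =>
      (hu.mul hf.continuous_lapE).integrable_of_hasCompactSupport hfs.lapE.mul_left
    simp only [hsum]
    rw [integral_add (hint hΘ hΘs) (hint hΦ hΦs), hΘint, zero_add,
      ← setIntegral_eq_integral_of_forall_compl_eq_zero (s := S) fun z hz => by
        rw [lapE_eq_zero_of_forall_compl hS hΦ0 hz, mul_zero], ← Real.norm_eq_abs]
    calc _ ≤ ε * (C * a) * (volume : Measure (ESp d)).real S := by
          refine norm_setIntegral_le_of_norm_le_const hSfin fun z hz => ?_
          rw [norm_mul]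
          refine mul_le_mul (hu_S z hz) (hC a ha1 z ?_) (norm_nonneg _) hε.le
          have := hz.1
          rwa [le_div_iff₀ ha0, mul_comm, ← abs_of_pos ha0, ← abs_mul] at this
      _ ≤ ε * (C * a) * (2 * (2 / a) * (2 * M) ^ (d + 1)) := by
          gcongr
          exact measureReal_slab_le hM0.le (by positivity)
      _ = ε * D := by
          rw [hD]
          field_simp
          ring
  by_contra hne
  have hpos := abs_pos.2 hne
  have h := key (|∫ z, u z * lapE ψ z| / (2 * (D + 1))) (by positivity)
  rw [div_mul_eq_mul_div, le_div_iff₀ (by positivity)] at h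
  nlinarith

theorem integral_mul_lapE_eq_zero {u : ESp d → ℝ} (hu : Continuous u)
    (huodd : ∀ z, u (reflect d z) = -u z) (hu2 : ∀ z : ESp d, z 0 ≠ 0 → ContDiffAt ℝ 2 u z)
    (hlap : ∀ z : ESp d, z 0 ≠ 0 → lapE u z = 0) {Ψ : ESp d → ℝ} (hΨ : ContDiff ℝ 2 Ψ)
    (hs : HasCompactSupport Ψ) : ∫ z, u z * lapE Ψ z = 0 := by
  have hΨR : ContDiff ℝ 2 fun z => -1 * Ψ (reflect d z) :=
    contDiff_const.mul (hΨ.comp (reflect d).contDiff)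
  have hsR : HasCompactSupport fun z => -1 * Ψ (reflect d z) :=
    (hs.comp_homeomorph (reflect d).toHomeomorph).mul_left
  have h : ∫ z, u z * lapE (fun z => Ψ z + -1 * Ψ (reflect d z)) z = 0 :=
    integral_mul_lapE_of_odd hu huodd hu2 hlap (hΨ.add hΨR) (hs.add hsR) fun z => by simp
  have hexp : ∀ z, u z * lapE (fun z => Ψ z + -1 * Ψ (reflect d z)) z =
      u z * lapE Ψ z + u (reflect d z) * lapE Ψ (reflect d z) := fun z => by
    have := lapE_add hΨ hΨR z
    rw [lapE_const_mul (fun y => Ψ (reflect d y)), lapE_comp_reflect] at this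
    rw [huodd]
    rw [this]
    ring
  have hint : Integrable fun z => u z * lapE Ψ z :=
    (hu.mul hΨ.continuous_lapE).integrable_of_hasCompactSupport hs.lapE.mul_left
  have hmp : MeasurePreserving (reflect d) := (reflect d).measurePreserving
  have hemb := (reflect d).toHomeomorph.measurableEmbedding
  have hR : ∫ z, u (reflect d z) * lapE Ψ (reflect d z) = ∫ z, u z * lapE Ψ z :=
    hmp.integral_comp hemb fun z => u z * lapE Ψ z
  have hintR : Integrable fun z => u (reflect d z) * lapE Ψ (reflect d z) :=
    (hmp.integrable_comp_emb hemb).2 hint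
  simp only [hexp] at h
  rw [integral_add hint hintR, hR] at h
  linarith

/-- The Schwarz reflection principle for harmonic functions on the half-space. -/
theorem contDiff_oddExt {v : ESp d → ℝ} (hcont : ContinuousOn v (closure (HalfSpace d)))
    (hC2 : ContDiffOn ℝ 2 v (HalfSpace d)) (hharm : ∀ z ∈ HalfSpace d, lapE v z = 0)
    (hbd : ∀ z : ESp d, z 0 = 0 → v z = 0) : ContDiff ℝ 2 (oddExt v) :=
  contDiff_of_weakly_harmonic (continuous_oddExt hcont hbd) fun _ hΨ hs =>
    integral_mul_lapE_eq_zero (continuous_oddExt hcont hbd) (oddExt_reflect hbd)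
      (fun _ hz => contDiffAt_oddExt hbd hC2 hz) (fun _ hz => lapE_oddExt hbd hharm hz) hΨ hs

/-- Schwarz reflection: the odd extension is harmonic. -/
theorem lapE_oddExt_eq_zero {v : ESp d → ℝ} (hcont : ContinuousOn v (closure (HalfSpace d)))
    (hC2 : ContDiffOn ℝ 2 v (HalfSpace d)) (hharm : ∀ z ∈ HalfSpace d, lapE v z = 0)
    (hbd : ∀ z : ESp d, z 0 = 0 → v z = 0) (z : ESp d) : lapE (oddExt v) z = 0 := by
  have hc := (contDiff_oddExt hcont hC2 hharm hbd).continuous_lapE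
  exact congrFun (hc.ext_on dense_apply_zero_ne continuous_const
    fun y hy => lapE_oddExt hbd hharm hy) z

/-- The reflection in the hyperplane `{z 0 = 0}`, on the unit sphere. -/
def reflectSphere (d : ℕ) : USph d ≃ₜ USph d where
  toFun θ := ⟨reflect d θ, by simp⟩
  invFun θ := ⟨reflect d θ, by simp⟩
  left_inv θ := by simp
  right_inv θ := by simp
  continuous_toFun := by
    have := (reflect d).continuous
    fun_prop
  continuous_invFun := by
    have := (reflect d).continuous
    fun_prop

theorem coe_reflectSphere (θ : USph d) : (reflectSphere d θ : ESp d) = reflect d θ := rfl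

theorem measurePreserving_reflectSphere :
    MeasurePreserving (reflectSphere d) (sphMeasure d) (sphMeasure d) := by
  refine ⟨(reflectSphere d).continuous.measurable, Measure.ext fun s hs => ?_⟩
  have hms := (reflectSphere d).continuous.measurable hs
  rw [Measure.map_apply (reflectSphere d).continuous.measurable hs,
    Measure.toSphere_apply' _ hms, Measure.toSphere_apply' _ hs,
    ← ((reflect d).measurePreserving).measure_preimage_emb
      (reflect d).toHomeomorph.measurableEmbedding]
  congr 2
  ext z
  simp only [Set.mem_smul, mem_preimage]
  constructor
  · rintro ⟨t, ht, _, ⟨θ, hθ, rfl⟩, h⟩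
    exact ⟨t, ht, _, ⟨_, hθ, rfl⟩, by rw [coe_reflectSphere, ← map_smul, h, reflect_reflect]⟩
  · rintro ⟨t, ht, _, ⟨θ, hθ, rfl⟩, h⟩
    refine ⟨t, ht, _, ⟨reflectSphere d θ, ?_, rfl⟩, ?_⟩
    · have : reflectSphere d (reflectSphere d θ) = θ := Subtype.ext (reflect_reflect _)
      simpa [this] using hθ
    · rw [coe_reflectSphere, ← map_smul, h]

theorem measurableSet_hemisphere : MeasurableSet (Hemisphere d) :=
  (isOpen_lt continuous_const (continuous_coord_zero.comp continuous_subtype_val)).measurableSet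

/-- An integral over the sphere in terms of the upper hemisphere, for functions vanishing on the
equator. -/
theorem integral_sphere_eq_two_mul_setIntegral {f : USph d → ℝ} (hf : Continuous f)
    (hR : ∀ θ, f (reflectSphere d θ) = f θ) (h0 : ∀ θ : USph d, (θ : ESp d) 0 = 0 → f θ = 0) :
    ∫ θ, f θ ∂sphMeasure d = 2 * ∫ θ in Hemisphere d, f θ ∂sphMeasure d := by
  have hint : Integrable ((Hemisphere d).indicator f) (sphMeasure d) :=
    (hf.integrable_of_hasCompactSupport (HasCompactSupport.of_compactSpace _)).indicator
      measurableSet_hemisphere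
  have hemb := (reflectSphere d).measurableEmbedding
  have hintR : Integrable (fun θ => (Hemisphere d).indicator f (reflectSphere d θ))
      (sphMeasure d) := (measurePreserving_reflectSphere.integrable_comp_emb hemb).2 hint
  have hexp : ∀ θ, f θ = (Hemisphere d).indicator f θ +
      (Hemisphere d).indicator f (reflectSphere d θ) := fun θ => by
    have hmem : ∀ θ : USph d, θ ∈ Hemisphere d ↔ 0 < (θ : ESp d) 0 := fun _ => Iff.rfl
    simp only [indicator, hmem, coe_reflectSphere, reflect_apply_zero, hR]
    rcases lt_trichotomy ((θ : ESp d) 0) 0 with h | h | h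
    · simp [h, h.not_gt]
    · simp [h, h0 θ h]
    · simp [h, h.not_gt]
  calc ∫ θ, f θ ∂sphMeasure d = ∫ θ, ((Hemisphere d).indicator f θ +
        (Hemisphere d).indicator f (reflectSphere d θ)) ∂sphMeasure d :=
        integral_congr_ae (Eventually.of_forall hexp)
    _ = _ := by
        rw [integral_add hint hintR, measurePreserving_reflectSphere.integral_comp hemb,
          integral_indicator measurableSet_hemisphere, two_mul]

/-- An integral over a ball in terms of the upper half ball, for even functions. -/
theorem setIntegral_ball_eq_two_mul_setIntegral {f : ESp d → ℝ} (hf : Continuous f)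
    (hR : ∀ z, f (reflect d z) = f z) (r : ℝ) :
    ∫ z in ball 0 r, f z = 2 * ∫ z in HalfSpace d ∩ ball 0 r, f z := by
  have hmeas : MeasurableSet (HalfSpace d ∩ ball 0 r) :=
    (isOpen_halfSpace.inter isOpen_ball).measurableSet
  have hint : Integrable ((HalfSpace d ∩ ball 0 r).indicator f) := by
    rw [integrable_indicator_iff hmeas]
    exact (hf.continuousOn.integrableOn_compact (isCompact_closedBall 0 r)).mono_set
      (inter_subset_right.trans ball_subset_closedBall)
  have hmp : MeasurePreserving (reflect d) := (reflect d).measurePreserving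
  have hemb := (reflect d).toHomeomorph.measurableEmbedding
  have hintR : Integrable fun z => (HalfSpace d ∩ ball 0 r).indicator f (reflect d z) :=
    (hmp.integrable_comp_emb hemb).2 hint
  have hnull : volume {z : ESp d | z 0 = 0} = 0 := by
    refine Measure.addHaar_submodule volume
      (LinearMap.ker (EuclideanSpace.proj 0 : ESp d →L[ℝ] ℝ).toLinearMap) fun h => ?_
    have : EuclideanSpace.single (0 : Fin (d + 2)) (1 : ℝ) ∈
      LinearMap.ker (EuclideanSpace.proj 0 : ESp d →L[ℝ] ℝ).toLinearMap := h ▸ trivial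
    simp at this
  have hexp : ∀ᵐ z : ESp d, (ball 0 r).indicator f z = (HalfSpace d ∩ ball 0 r).indicator f z +
      (HalfSpace d ∩ ball 0 r).indicator f (reflect d z) := by
    filter_upwards [compl_mem_ae_iff.2 hnull] with z hz
    simp only [indicator, mem_inter_iff, mem_halfSpace, reflect_apply_zero, hR, mem_ball,
      dist_zero_right, LinearIsometryEquiv.norm_map]
    rcases lt_trichotomy (z 0) 0 with h | h | h
    · simp [h, h.not_gt]
    · exact absurd h hz
    · simp [h, h.not_gt]
  rw [← integral_indicator measurableSet_ball, integral_congr_ae hexp, integral_add hint hintR]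
  have hRint := hmp.integral_comp hemb ((HalfSpace d ∩ ball 0 r).indicator f)
  change ∫ z, (HalfSpace d ∩ ball 0 r).indicator f (reflect d z) = _ at hRint
  rw [hRint, integral_indicator hmeas, two_mul]

/-- The frequency on the half-space through boundary integrals of the odd extension. -/
theorem freqHS_eq {v : ESp d → ℝ} (hcont : ContinuousOn v (closure (HalfSpace d)))
    (hC2 : ContDiffOn ℝ 2 v (HalfSpace d)) (hharm : ∀ z ∈ HalfSpace d, lapE v z = 0)
    (hbd : ∀ z : ESp d, z 0 = 0 → v z = 0) {r : ℝ} (hr : 0 < r) :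
    freqHS v r = (r * ∫ θ, oddExt v (r • (θ : ESp d)) * fderiv ℝ (oddExt v) (r • (θ : ESp d)) θ
      ∂sphMeasure d) / ∫ θ, oddExt v (r • (θ : ESp d)) ^ 2 ∂sphMeasure d := by
  have hu := contDiff_oddExt hcont hC2 hharm hbd
  have hodd := oddExt_reflect hbd
  have hgrad : ∫ z in HalfSpace d ∩ ball 0 r, gradSqE v z =
      ∫ z in HalfSpace d ∩ ball 0 r, gradSqE (oddExt v) z :=
    setIntegral_congr_fun (isOpen_halfSpace.inter isOpen_ball).measurableSet fun z hz =>
      (gradSqE_congr_of_eventuallyEq (oddExt_eventuallyEq v hz.1)).symm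
  have hden : ∫ θ in Hemisphere d, v (r • (θ : ESp d)) ^ 2 ∂sphMeasure d =
      ∫ θ in Hemisphere d, oddExt v (r • (θ : ESp d)) ^ 2 ∂sphMeasure d :=
    setIntegral_congr_fun measurableSet_hemisphere fun θ (hθ : 0 < (θ : ESp d) 0) => by
      have : 0 ≤ (r • (θ : ESp d)) 0 := (mul_pos hr hθ).le
      simp only [oddExt_of_nonneg v this]
  have hgc : Continuous (gradSqE (oddExt v)) :=
    continuous_finsetSum _ fun i _ => ((hu.pd_contDiff (m := 1) (by norm_num) i).continuous).pow 2
  have hgR : ∀ z, gradSqE (oddExt v) (reflect d z) = gradSqE (oddExt v) z := fun z => by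
    rw [← gradSqE_comp_reflect]
    simp only [hodd, gradSqE]
    refine Finset.sum_congr rfl fun i _ => ?_
    rw [fderiv_fun_neg]
    simp
  have h1 := setIntegral_ball_eq_two_mul_setIntegral hgc hgR r
  have h2 := integral_sphere_eq_two_mul_setIntegral
    (f := fun θ : USph d => oddExt v (r • (θ : ESp d)) ^ 2)
    (by have := hu.continuous; fun_prop)
    (fun θ => by rw [coe_reflectSphere, ← map_smul, hodd, neg_sq])
    (fun θ h => by
      have h0 : (r • (θ : ESp d)) 0 = 0 := by simp [h]
      simp [oddExt_of_nonneg v h0.ge, hbd _ h0])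
  rw [setIntegral_ball_gradSqE hu (lapE_oddExt_eq_zero hcont hC2 hharm hbd) hr] at h1
  have hpow : r ^ ((2 : ℝ) - ((d : ℝ) + 2)) * r ^ (d + 1) = r := by
    rw [← Real.rpow_natCast, ← Real.rpow_add hr]
    simp
  rw [freqHS, hgrad, hden, h2, ← mul_div_mul_left _ _ (two_ne_zero' ℝ)]
  congr 1
  linear_combination (-r ^ ((2 : ℝ) - ((d : ℝ) + 2))) * h1 +
    (∫ θ, oddExt v (r • (θ : ESp d)) * fderiv ℝ (oddExt v) (r • (θ : ESp d)) θ ∂sphMeasure d) * hpow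

/-- Homogeneity on the half-space passes to the odd extension. -/
theorem oddExt_smul {v : ESp d → ℝ} (hbd : ∀ z : ESp d, z 0 = 0 → v z = 0) {Nbar : ℝ}
    (hom : ∀ t : ℝ, 0 < t → ∀ z ∈ HalfSpace d, v (t • z) = t ^ Nbar * v z) {t : ℝ} (ht : 0 < t)
    (z : ESp d) : oddExt v (t • z) = t ^ Nbar * oddExt v z := by
  have hpos : ∀ y : ESp d, 0 < y 0 → oddExt v (t • y) = t ^ Nbar * oddExt v y := fun y hy => by
    have h : 0 < (t • y) 0 := mul_pos ht hy
    rw [oddExt_of_nonneg v h.le, oddExt_of_nonneg v hy.le, hom t ht y hy]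
  rcases lt_trichotomy (z 0) 0 with h | h | h
  · have h' : 0 < reflect d z 0 := by simpa using h
    have := hpos _ h'
    rw [← map_smul, oddExt_reflect hbd, oddExt_reflect hbd] at this
    linarith
  · have h' : (t • z) 0 = 0 := by simp [h]
    rw [oddExt_of_nonneg v h'.ge, oddExt_of_nonneg v h.ge, hbd _ h', hbd _ h, mul_zero]
  · exact hpos z h

/-- Euler's identity for positively homogeneous functions. -/
theorem fderiv_apply_self_of_homogeneous {u : ESp d → ℝ} {z : ESp d} (hu : DifferentiableAt ℝ u z)
    {Nbar : ℝ} (hom : ∀ t : ℝ, 0 < t → u (t • z) = t ^ Nbar * u z) :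
    fderiv ℝ u z z = Nbar * u z := by
  have h1 : HasDerivAt (fun t : ℝ => u (t • z)) (fderiv ℝ u z z) 1 := by
    have hz : HasDerivAt (fun t : ℝ => t • z) z 1 := by
      simpa using (hasDerivAt_id (1 : ℝ)).smul_const z
    have hu' : HasFDerivAt u (fderiv ℝ u z) ((1 : ℝ) • z) := by
      rw [one_smul]
      exact hu.hasFDerivAt
    exact hu'.comp_hasDerivAt 1 hz
  have h2 : HasDerivAt (fun t : ℝ => t ^ Nbar * u z) (Nbar * u z) 1 := by
    simpa using (Real.hasDerivAt_rpow_const (x := 1) (p := Nbar) (Or.inl one_ne_zero)).mul_const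
      (u z)
  refine h1.unique (h2.congr_of_eventuallyEq ?_)
  filter_upwards [Ioi_mem_nhds one_pos] with t ht using hom t ht

end HalfSpaceHarmonic

/-- For `v` harmonic on the half-space, continuous up to the closure,
vanishing on `{z₁ = 0}` and not identically zero: the Almgren frequency `N(v)(r)` is
constantly equal to `N̄` iff `v` is positively homogeneous of degree `N̄`; and in that case
the homogeneous function `z ↦ |z|^N̄ v(z/|z|)` built from the restriction of `v` to the
upper hemisphere is harmonic on `H` (equivalently, `N̄(N̄-1) + N̄(N-1)` is a Dirichlet
eigenvalue of the spherical Laplacian on the hemisphere). -/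
theorem statement15 {d : ℕ} (v : EuclideanSpace ℝ (Fin (d+2)) → ℝ) (Nbar : ℝ)
    (hcont : ContinuousOn v (closure (HalfSpace d)))
    (hC2 : ContDiffOn ℝ 2 v (HalfSpace d))
    (hharm : ∀ z ∈ HalfSpace d, lapE v z = 0)
    (hbd : ∀ z : EuclideanSpace ℝ (Fin (d+2)), z 0 = 0 → v z = 0)
    (hnontriv : ∃ z ∈ HalfSpace d, v z ≠ 0) :
    ((∀ r : ℝ, 0 < r → freqHS v r = Nbar) ↔
      (∀ t : ℝ, 0 < t → ∀ z ∈ HalfSpace d, v (t • z) = t ^ Nbar * v z)) ∧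
    ((∀ t : ℝ, 0 < t → ∀ z ∈ HalfSpace d, v (t • z) = t ^ Nbar * v z) →
      ∀ z ∈ HalfSpace d, lapE (fun z' => ‖z'‖ ^ Nbar * v (‖z'‖⁻¹ • z')) z = 0) := by
  have hu := contDiff_oddExt hcont hC2 hharm hbd
  have hlap := lapE_oddExt_eq_zero hcont hC2 hharm hbd
  have hfreq := fun (r : ℝ) (hr : 0 < r) => freqHS_eq hcont hC2 hharm hbd hr
  have hc : ∀ r : ℝ, Continuous fun θ : USph d => oddExt v (r • (θ : ESp d)) := fun r => by
    have := hu.continuous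
    fun_prop
  refine ⟨⟨fun hN t ht z hz => ?_, fun hom r hr => ?_⟩, fun hom z hz => ?_⟩
  · have hz0 : z ≠ 0 := by
      rintro rfl
      simp [mem_halfSpace] at hz
    have htz : 0 < (t • z) 0 := mul_pos ht hz
    rw [← oddExt_of_nonneg v htz.le, ← oddExt_of_nonneg v (le_of_lt hz)]
    refine homogeneous_of_frequency_eq hu hlap (fun r hr => ?_) ht hz0
    by_cases h0 : ∫ θ, oddExt v (r • (θ : ESp d)) ^ 2 ∂sphMeasure d = 0
    · have hzero := eq_zero_of_integral_sphere_sq_eq_zero (hc r) h0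
      simp [hzero]
    · rw [← hN r hr, hfreq r hr, div_mul_cancel₀ _ h0]
  · have homu := fun (t : ℝ) (ht : 0 < t) (z : ESp d) => oddExt_smul hbd hom ht z
    have hEuler : ∀ θ : USph d, r * (oddExt v (r • (θ : ESp d)) *
        fderiv ℝ (oddExt v) (r • (θ : ESp d)) θ) = Nbar * oddExt v (r • (θ : ESp d)) ^ 2 :=
      fun θ => by
        have h := fderiv_apply_self_of_homogeneous (hu.differentiable two_ne_zero (r • (θ : ESp d)))
          fun t ht => homu t ht _
        rw [map_smul, smul_eq_mul] at h
        linear_combination oddExt v (r • (θ : ESp d)) * h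
    have hden : ∫ θ, oddExt v (r • (θ : ESp d)) ^ 2 ∂sphMeasure d ≠ 0 := fun h0 => by
      obtain ⟨z, hz, hvz⟩ := hnontriv
      have hz0 : 0 < ‖z‖ := norm_pos_iff.2 (by
        rintro rfl
        simp [mem_halfSpace] at hz)
      have h := eq_zero_of_integral_sphere_sq_eq_zero (hc r) h0
        ⟨‖z‖⁻¹ • z, by simp [norm_smul, inv_mul_cancel₀ hz0.ne']⟩
      simp only [smul_smul] at h
      rw [homu _ (by positivity), oddExt_of_nonneg v (le_of_lt hz)] at h
      exact (mul_ne_zero (Real.rpow_pos_of_pos (by positivity) _).ne' hvz) h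
    rw [hfreq r hr, div_eq_iff hden, ← integral_const_mul, ← integral_const_mul]
    exact integral_congr_ae (Eventually.of_forall hEuler)
  · rw [← hharm z hz]
    refine lapE_congr_of_eventuallyEq ?_
    filter_upwards [isOpen_halfSpace.mem_nhds hz] with y hy
    have hy0 : 0 < ‖y‖ := norm_pos_iff.2 (by
      rintro rfl
      simp [mem_halfSpace] at hy)
    rw [hom _ (inv_pos.2 hy0) y hy, ← mul_assoc, Real.inv_rpow hy0.le,
      mul_inv_cancel₀ (Real.rpow_pos_of_pos hy0 _).ne', one_mul]
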